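/- arXiv:1806.09676 — 3 statements merged into one kernel-verified Lean document; each statement's English description precedes it below -/
import Mathlib

section
/- There is a constant K > 0 such that for every ε with 0 < ε < 1/4, every pair of separable commutative C*-algebras A and B, and every ε-*-homomorphism φ : A → B, there is a *-homomorphism ψ : A → B such that ‖φ(x) − ψ(x)‖ < K·√ε for all x in the closed unit ball of A. Moreover, there is ε₀ > 0 such that if in addition ε < ε₀ and φ is an ε-isomorphism, then ψ can be chosen to be a *-isomorphism of A onto B. -/
section ApproxMaps

variable {A B : Type*} [NonUnitalCStarAlgebra A] [NonUnitalCStarAlgebra B]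

/-- `φ` is `ε`-linear. -/
def EpsLinear (ε : ℝ) (φ : A → B) : Prop :=
  ∀ x y : A, ‖x‖ ≤ 1 → ‖y‖ ≤ 1 → ∀ lam mu : ℂ, ‖lam‖ ≤ 1 → ‖mu‖ ≤ 1 →
    ‖φ (lam • x + mu • y) - (lam • φ x + mu • φ y)‖ < ε

/-- `φ` is `ε`-`*`-preserving. -/
def EpsStarPreserving (ε : ℝ) (φ : A → B) : Prop :=
  ∀ x : A, ‖x‖ ≤ 1 → ‖φ (star x) - star (φ x)‖ < ε

/-- `φ` is `ε`-multiplicative. -/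
def EpsMultiplicative (ε : ℝ) (φ : A → B) : Prop :=
  ∀ x y : A, ‖x‖ ≤ 1 → ‖y‖ ≤ 1 → ‖φ (x * y) - φ x * φ y‖ < ε

/-- `φ` is `ε`-isometric. -/
def EpsIsometric (ε : ℝ) (φ : A → B) : Prop :=
  ∀ x : A, ‖x‖ ≤ 1 → |‖x‖ - ‖φ x‖| < ε

/-- `φ` is `ε`-surjective. -/
def EpsSurjective (ε : ℝ) (φ : A → B) : Prop :=
  ∀ b : B, ‖b‖ ≤ 1 → ∃ x : A, ‖x‖ ≤ 1 ∧ ‖b - φ x‖ < ε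

/-- An `ε`-`*`-homomorphism: a contraction on the unit ball which is `ε`-linear,
`ε`-`*`-preserving and `ε`-multiplicative. -/
def EpsStarHom (ε : ℝ) (φ : A → B) : Prop :=
  (∀ x : A, ‖x‖ ≤ 1 → ‖φ x‖ ≤ 1) ∧ EpsLinear ε φ ∧ EpsStarPreserving ε φ ∧
    EpsMultiplicative ε φ

/-- An `ε`-embedding: an `ε`-`*`-homomorphism which is `ε`-isometric. -/
def EpsEmbedding (ε : ℝ) (φ : A → B) : Prop :=
  EpsStarHom ε φ ∧ EpsIsometric ε φ

/-- An `ε`-isomorphism: an `ε`-embedding which is `ε`-surjective. -/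
def EpsIsomorphism (ε : ℝ) (φ : A → B) : Prop :=
  EpsEmbedding ε φ ∧ EpsSurjective ε φ

end ApproxMaps

open WeakDual in
/-- Gelfand duality for non-unital algebras: a commutative C*-algebra is isometric to the algebra
of continuous functions vanishing at a point of a compact Hausdorff space. -/
theorem exists_gelfand_model (A : Type) [NonUnitalCommCStarAlgebra A] :
    ∃ (X : Type) (_ : TopologicalSpace X) (_ : CompactSpace X) (_ : T2Space X) (p : X)
      (ι : A →⋆ₙₐ[ℂ] C(X, ℂ)), (∀ a, ‖ι a‖ = ‖a‖) ∧ (∀ a, ι a p = 0) ∧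
        ∀ f : C(X, ℂ), f p = 0 → ∃ a, ι a = f := by
  let G := gelfandStarTransform (Unitization ℂ A)
  let p : characterSpace ℂ (Unitization ℂ A) :=
    CharacterSpace.equivAlgHom.symm (Unitization.fstHom ℂ A)
  have hp (u : Unitization ℂ A) : G u p = u.fst := rfl
  refine ⟨characterSpace ℂ (Unitization ℂ A), inferInstance, inferInstance, inferInstance, p,
    ((G : Unitization ℂ A →⋆ₐ[ℂ] C(characterSpace ℂ (Unitization ℂ A), ℂ)).toNonUnitalStarAlgHom).comp
      (Unitization.inrNonUnitalStarAlgHom ℂ A), fun a => ?_, fun a => ?_, fun f hf => ?_⟩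
  · have h := (gelfandTransform_isometry (Unitization ℂ A)).norm_map_of_map_zero (map_zero _)
      (a : Unitization ℂ A)
    exact h.trans (Unitization.norm_inr a)
  · exact hp a
  · obtain ⟨u, rfl⟩ := G.surjective f
    refine ⟨u.snd, ?_⟩
    change G (u.snd : Unitization ℂ A) = G u
    congr 1
    ext
    · exact hf.symm.trans (hp u)
    · simp

theorem continuous_of_isClosed_graph {X Y : Type*} [TopologicalSpace X] [TopologicalSpace Y]
    [CompactSpace X] {θ : Y → X} (h : IsClosed {z : Y × X | z.2 = θ z.1}) : Continuous θ := by
  refine continuous_iff_isClosed.2 fun s hs => ?_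
  have := isClosedMap_fst_of_compactSpace _ (h.inter (hs.preimage continuous_snd))
  convert this using 1
  ext y
  simp

/-- The piecewise linear function vanishing up to `τ` and equal to `1` from `2 * τ` on. -/
noncomputable def ramp (τ s : ℝ) : ℝ := max 0 (min 1 (s / τ - 1))

theorem continuous_ramp (τ : ℝ) : Continuous (ramp τ) := by unfold ramp; fun_prop

theorem ramp_nonneg (τ s : ℝ) : 0 ≤ ramp τ s := le_max_left _ _

theorem ramp_le_one (τ s : ℝ) : ramp τ s ≤ 1 := by simp [ramp]

theorem ramp_eq_zero {τ s : ℝ} (hτ : 0 < τ) (h : s ≤ τ) : ramp τ s = 0 := by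
  have : s / τ ≤ 1 := (div_le_one hτ).2 h
  exact max_eq_left ((min_le_right _ _).trans (by linarith))

theorem ramp_eq_one {τ s : ℝ} (hτ : 0 < τ) (h : 2 * τ ≤ s) : ramp τ s = 1 := by
  have : 2 ≤ s / τ := (le_div_iff₀ hτ).2 h
  rw [ramp, min_eq_left (by linarith), max_eq_right zero_le_one]

section ApproxCharacter

variable {A : Type*} [NonUnitalCommCStarAlgebra A] {ε : ℝ} {Φ : A → ℂ}

theorem EpsStarHom.norm_apply_smul_sub_le (hΦ : EpsStarHom ε Φ) {c : ℂ} (hc : ‖c‖ ≤ 1) {a : A}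
    (ha : ‖a‖ ≤ 1) : ‖Φ (c • a) - c * Φ a‖ ≤ ε := by
  simpa using (hΦ.2.1 a 0 ha (by simp) c 0 hc (by simp)).le

theorem EpsStarHom.norm_apply_sub_sub_le (hΦ : EpsStarHom ε Φ) {a b : A}
    (ha : ‖a‖ ≤ 1) (hb : ‖b‖ ≤ 1) : ‖Φ (a - b) - (Φ a - Φ b)‖ ≤ ε := by
  simpa [sub_eq_add_neg] using (hΦ.2.1 a b ha hb 1 (-1) (by simp) (by simp)).le

theorem EpsStarHom.norm_apply_zero_le (hΦ : EpsStarHom ε Φ) : ‖Φ 0‖ ≤ ε := by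
  simpa using hΦ.norm_apply_smul_sub_le (c := 0) (by simp) (a := 0) (by simp)

variable {X : Type*} [TopologicalSpace X] {p : X} {ι : A →⋆ₙₐ[ℂ] C(X, ℂ)}

/-- `IsLarge ι Φ V` says that `Φ` is large at some element supported in `V`. -/
def IsLarge (ι : A →⋆ₙₐ[ℂ] C(X, ℂ)) (Φ : A → ℂ) (V : Set X) : Prop :=
  ∃ q : A, ‖q‖ ≤ 1 ∧ 9 / 10 ≤ ‖Φ q‖ ∧ ∀ x, ι q x ≠ 0 → x ∈ V

theorem IsLarge.mono {V W : Set X} (h : IsLarge ι Φ V) (hVW : V ⊆ W) : IsLarge ι Φ W := by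
  obtain ⟨q, h1, h2, h3⟩ := h
  exact ⟨q, h1, h2, fun x hx => hVW (h3 x hx)⟩

variable [CompactSpace X]

theorem norm_le_of_gelfand (hι : ∀ a, ‖ι a‖ = ‖a‖) {a : A} {r : ℝ} (hr : 0 ≤ r)
    (h : ∀ x, ‖ι a x‖ ≤ r) : ‖a‖ ≤ r := by
  rw [← hι]
  exact (ContinuousMap.norm_le _ hr).2 h

theorem norm_gelfand_apply_le (hι : ∀ a, ‖ι a‖ = ‖a‖) (a : A) (x : X) : ‖ι a x‖ ≤ ‖a‖ :=
  hι a ▸ (ι a).norm_coe_le_norm x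

/-- If an approximate character is not small at `a`, then it is close to `1` at some element
supported where `a` is not small. -/
theorem EpsStarHom.exists_norm_apply_sub_one_le (hΦ : EpsStarHom ε Φ) (hι : ∀ a, ‖ι a‖ = ‖a‖)
    (hp : ∀ a, ι a p = 0) (hs : ∀ f : C(X, ℂ), f p = 0 → ∃ a, ι a = f) {τ : ℝ} (hτ : 0 < τ)
    (hτ' : 4 * τ ≤ 1) {a : A} (ha : ‖a‖ ≤ 1) (h : 5 * τ + 2 * ε ≤ ‖Φ a‖) :
    ∃ q : A, ‖q‖ ≤ 1 ∧ ‖Φ q - 1‖ ≤ ε / τ ∧ ∀ x, ι q x ≠ 0 → τ < ‖ι a x‖ := by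
  have hcr (σ : ℝ) : Continuous fun x => ((ramp σ ‖ι a x‖ : ℝ) : ℂ) :=
    Complex.continuous_ofReal.comp ((continuous_ramp σ).comp (by fun_prop))
  have h2 : 0 < 2 * τ := by positivity
  have h0 {σ : ℝ} (hσ : 0 < σ) : ramp σ ‖ι a p‖ = 0 := ramp_eq_zero hσ (by simp [hp, hσ.le])
  obtain ⟨b, hb⟩ := hs ⟨fun x => ι a x * (ramp (2 * τ) ‖ι a x‖ : ℝ),
    (ι a).continuous.mul (hcr _)⟩ (by simp [hp])
  obtain ⟨q, hq⟩ := hs ⟨fun x => (ramp τ ‖ι a x‖ : ℝ), hcr _⟩ (by simp [h0 hτ])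
  have hbx (x) : ι b x = ι a x * (ramp (2 * τ) ‖ι a x‖ : ℝ) := by rw [hb]; rfl
  have hqx (x) : ι q x = (ramp τ ‖ι a x‖ : ℝ) := by rw [hq]; rfl
  have hax (x) : ‖ι a x‖ ≤ 1 := (norm_gelfand_apply_le hι a x).trans ha
  have hq1 : ‖q‖ ≤ 1 := norm_le_of_gelfand hι zero_le_one fun x => by
    rw [hqx, Complex.norm_real, Real.norm_of_nonneg (ramp_nonneg _ _)]
    exact ramp_le_one _ _
  have hb1 : ‖b‖ ≤ 1 := norm_le_of_gelfand hι zero_le_one fun x => by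
    rw [hbx, norm_mul, Complex.norm_real, Real.norm_of_nonneg (ramp_nonneg _ _)]
    exact mul_le_one₀ (hax x) (ramp_nonneg _ _) (ramp_le_one _ _)
  have hab : ‖a - b‖ ≤ 4 * τ := norm_le_of_gelfand hι (by positivity) fun x => by
    have e : ι (a - b) x = ι a x * ((1 - ramp (2 * τ) ‖ι a x‖ : ℝ) : ℂ) := by
      rw [map_sub, ContinuousMap.sub_apply, hbx]; push_cast; ring
    rw [e, norm_mul, Complex.norm_real,
      Real.norm_of_nonneg (sub_nonneg.2 (ramp_le_one _ _))]
    rcases le_total (2 * (2 * τ)) ‖ι a x‖ with h' | h'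
    · rw [ramp_eq_one h2 h']; simp [hτ.le]
    · have := mul_le_mul h' (sub_le_self 1 (ramp_nonneg (2 * τ) ‖ι a x‖))
        (sub_nonneg.2 (ramp_le_one _ _)) (by positivity)
      linarith
  have hqb : q * b = b := by
    have hinj : Function.Injective ι := (AddMonoidHomClass.isometry_of_norm ι hι).injective
    refine hinj (ContinuousMap.ext fun x => ?_)
    rw [map_mul, ContinuousMap.mul_apply, hqx, hbx]
    rcases le_total (2 * τ) ‖ι a x‖ with h' | h'
    · simp [ramp_eq_one hτ h']
    · simp [ramp_eq_zero h2 h']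
  have hΦab : ‖Φ (a - b)‖ ≤ 4 * τ + ε := by
    have hc : ‖((4 * τ : ℝ) : ℂ)‖ = 4 * τ := by
      rw [Complex.norm_real, Real.norm_of_nonneg (by positivity)]
    have hne : ((4 * τ : ℝ) : ℂ) ≠ 0 := by exact_mod_cast (by positivity : 4 * τ ≠ 0)
    have hu : ‖((4 * τ : ℝ) : ℂ)⁻¹ • (a - b)‖ ≤ 1 := by
      rw [norm_smul, norm_inv, hc, inv_mul_le_iff₀ (by positivity)]
      simpa using hab
    have h1 := hΦ.norm_apply_smul_sub_le (hc.trans_le hτ') hu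
    rw [smul_inv_smul₀ hne] at h1
    have h3 : ‖((4 * τ : ℝ) : ℂ) * Φ (((4 * τ : ℝ) : ℂ)⁻¹ • (a - b))‖ ≤ 4 * τ := by
      rw [norm_mul, hc]
      exact mul_le_of_le_one_right (by positivity) (hΦ.1 _ hu)
    linarith [norm_sub_norm_le (Φ (a - b))
      (((4 * τ : ℝ) : ℂ) * Φ (((4 * τ : ℝ) : ℂ)⁻¹ • (a - b)))]
  have hΦb : τ ≤ ‖Φ b‖ := by
    have h1 := hΦ.norm_apply_sub_sub_le ha hb1
    have h3 := norm_sub_norm_le (Φ a - Φ b) (Φ (a - b))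
    rw [norm_sub_rev] at h1
    linarith [norm_sub_norm_le (Φ a) (Φ b)]
  refine ⟨q, hq1, ?_, fun x hx => ?_⟩
  · have h1 := (hΦ.2.2.2 q b hq1 hb1).le
    rw [hqb, norm_sub_rev, ← sub_one_mul, norm_mul] at h1
    rw [le_div_iff₀ hτ]
    exact (mul_le_mul_of_nonneg_left hΦb (norm_nonneg _)).trans h1
  · by_contra! h'
    exact hx (by simp [hqx, ramp_eq_zero hτ h'])

theorem EpsStarHom.isLarge_of_le (hΦ : EpsStarHom ε Φ) (hι : ∀ a, ‖ι a‖ = ‖a‖)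
    (hp : ∀ a, ι a p = 0) (hs : ∀ f : C(X, ℂ), f p = 0 → ∃ a, ι a = f) {τ : ℝ} (hτ : 0 < τ)
    (hτ' : 4 * τ ≤ 1) (hε : 10 * ε ≤ τ) {a : A} (ha : ‖a‖ ≤ 1) (h : 5 * τ + 2 * ε ≤ ‖Φ a‖) :
    IsLarge ι Φ {x | τ < ‖ι a x‖} := by
  obtain ⟨q, hq, hq1, hqx⟩ := hΦ.exists_norm_apply_sub_one_le hι hp hs hτ hτ' ha h
  refine ⟨q, hq, ?_, hqx⟩
  have h1 : ε / τ ≤ 1 / 10 := by rw [div_le_iff₀ hτ]; linarith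
  have h2 := norm_sub_norm_le (1 : ℂ) (Φ q)
  rw [norm_sub_rev, norm_one] at h2
  linarith

theorem EpsStarHom.isLarge_inter (hΦ : EpsStarHom ε Φ) (hι : ∀ a, ‖ι a‖ = ‖a‖)
    (hp : ∀ a, ι a p = 0) (hs : ∀ f : C(X, ℂ), f p = 0 → ∃ a, ι a = f) (hε : ε ≤ 1 / 100)
    {V W : Set X} (hV : IsLarge ι Φ V) (hW : IsLarge ι Φ W) : IsLarge ι Φ (V ∩ W) := by
  obtain ⟨q, hq1, hq2, hq3⟩ := hV
  obtain ⟨r, hr1, hr2, hr3⟩ := hW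
  have h1 : ‖q * r‖ ≤ 1 := (norm_mul_le _ _).trans (mul_le_one₀ hq1 (norm_nonneg _) hr1)
  have h2 : 8 / 10 - ε ≤ ‖Φ (q * r)‖ := by
    have h := (hΦ.2.2.2 q r hq1 hr1).le
    have h' := norm_sub_norm_le (Φ q * Φ r) (Φ (q * r))
    rw [norm_sub_rev, norm_mul] at h'
    nlinarith
  refine (hΦ.isLarge_of_le hι hp hs (τ := 1 / 10) (by norm_num) (by norm_num) (by linarith)
    h1 (by linarith)).mono fun x hx => ?_
  have hx' : ι (q * r) x ≠ 0 := norm_pos_iff.1 (lt_trans (by norm_num) hx)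
  rw [map_mul, ContinuousMap.mul_apply] at hx'
  exact ⟨hq3 x (left_ne_zero_of_mul hx'), hr3 x (right_ne_zero_of_mul hx')⟩

theorem EpsStarHom.nonempty_of_isLarge (hΦ : EpsStarHom ε Φ) (hι : ∀ a, ‖ι a‖ = ‖a‖)
    (hε : ε ≤ 1 / 100) {V : Set X} (hV : IsLarge ι Φ V) : V.Nonempty := by
  obtain ⟨q, -, hq2, hq3⟩ := hV
  by_contra hne
  have hq : ‖q‖ ≤ 0 := norm_le_of_gelfand hι le_rfl fun x => by
    by_contra! h
    exact hne ⟨x, hq3 x (norm_pos_iff.1 h)⟩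
  rw [norm_le_zero_iff.1 hq] at hq2
  linarith [hΦ.norm_apply_zero_le]

/-- An approximate character with a large value is large near the level set of any element. -/
theorem EpsStarHom.isLarge_norm_sub_le (hΦ : EpsStarHom ε Φ) (hι : ∀ a, ‖ι a‖ = ‖a‖)
    (hp : ∀ a, ι a p = 0) (hs : ∀ f : C(X, ℂ), f p = 0 → ∃ a, ι a = f) (hε0 : 0 < ε)
    (hε : ε ≤ 1 / 100) (hlarge : IsLarge ι Φ Set.univ) {f : A} (hf : ‖f‖ ≤ 1) :
    IsLarge ι Φ {x | ‖ι f x - Φ f‖ ≤ 640 * ε} := by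
  obtain ⟨q, hq1, hq2, -⟩ := hlarge
  have hΦf : ‖Φ f‖ ≤ 1 := hΦ.1 f hf
  have hfq : ‖f * q‖ ≤ 1 := (norm_mul_le _ _).trans (mul_le_one₀ hf (norm_nonneg _) hq1)
  obtain ⟨h, hh⟩ : ∃ h : A, h = (1 / 2 : ℂ) • (f * q) + (-(Φ f / 2)) • q := ⟨_, rfl⟩
  have hc : ‖-(Φ f / 2)‖ ≤ 1 / 2 := by rw [norm_neg, norm_div]; norm_num; linarith
  have hh1 : ‖h‖ ≤ 1 := by
    have h1 : ‖(1 / 2 : ℂ) • (f * q)‖ ≤ 1 / 2 := by rw [norm_smul]; norm_num; linarith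
    have h2 : ‖(-(Φ f / 2)) • q‖ ≤ 1 / 2 := by
      rw [norm_smul]; nlinarith [norm_nonneg q, norm_nonneg (-(Φ f / 2))]
    rw [hh]
    linarith [norm_add_le ((1 / 2 : ℂ) • (f * q)) ((-(Φ f / 2)) • q)]
  have hΦh : ‖Φ h‖ ≤ 2 * ε := by
    have h1 := (hΦ.2.1 (f * q) q hfq hq1 (1 / 2) (-(Φ f / 2)) (by norm_num) (by linarith)).le
    rw [← hh] at h1
    have h2 := (hΦ.2.2.2 f q hf hq1).le
    have e : Φ h = (Φ h - ((1 / 2 : ℂ) • Φ (f * q) + (-(Φ f / 2)) • Φ q)) +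
        (1 / 2) * (Φ (f * q) - Φ f * Φ q) := by simp only [smul_eq_mul]; ring
    rw [e]
    refine (norm_add_le _ _).trans ?_
    rw [norm_mul]
    norm_num at h1 h2 ⊢
    linarith
  have hhx (x) : ι h x = (ι f x - Φ f) * ι q x / 2 := by
    rw [hh]
    simp only [map_add, map_smul, map_mul, ContinuousMap.add_apply, ContinuousMap.smul_apply,
      ContinuousMap.mul_apply, smul_eq_mul]
    ring
  obtain ⟨σ, hσ⟩ : ∃ σ, σ = 16 * ε := ⟨_, rfl⟩
  have hσ0 : 0 < σ := by rw [hσ]; positivity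
  have hmax (x) : 0 < max ‖ι h x‖ σ := lt_max_of_lt_right hσ0
  have hcr : Continuous fun x => ((ramp σ ‖ι h x‖ : ℝ) : ℂ) :=
    Complex.continuous_ofReal.comp ((continuous_ramp σ).comp (by fun_prop))
  have hcm : Continuous fun x => ((max ‖ι h x‖ σ : ℝ) : ℂ) :=
    Complex.continuous_ofReal.comp (by fun_prop)
  obtain ⟨k, hk⟩ := hs ⟨fun x => σ * star (ι h x) * (ramp σ ‖ι h x‖ : ℝ) /
      ((max ‖ι h x‖ σ : ℝ) : ℂ) ^ 2,
    ((continuous_const.mul (ι h).continuous.star).mul hcr).div (hcm.pow 2) fun x => by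
      simpa using (hmax x).ne'⟩ (by simp [hp])
  obtain ⟨m, hm⟩ := hs ⟨fun x => (ramp σ ‖ι h x‖ : ℝ), hcr⟩
    (by simp [hp, ramp_eq_zero hσ0 hσ0.le])
  have hkx (x) : ι k x = σ * star (ι h x) * (ramp σ ‖ι h x‖ : ℝ) /
      ((max ‖ι h x‖ σ : ℝ) : ℂ) ^ 2 := by rw [hk]; rfl
  have hmx (x) : ι m x = (ramp σ ‖ι h x‖ : ℝ) := by rw [hm]; rfl
  have hm1 : ‖m‖ ≤ 1 := norm_le_of_gelfand hι zero_le_one fun x => by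
    rw [hmx, Complex.norm_real, Real.norm_of_nonneg (ramp_nonneg _ _)]
    exact ramp_le_one _ _
  have hk1 : ‖k‖ ≤ 1 := norm_le_of_gelfand hι zero_le_one fun x => by
    rw [hkx, norm_div, norm_mul, norm_mul, norm_pow, norm_star, Complex.norm_real,
      Complex.norm_real, Complex.norm_real, Real.norm_of_nonneg (ramp_nonneg _ _),
      Real.norm_of_nonneg (hmax x).le, Real.norm_of_nonneg hσ0.le, div_le_one (pow_pos (hmax x) 2)]
    have h1 := le_max_left ‖ι h x‖ σ
    have h2 := le_max_right ‖ι h x‖ σ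
    calc σ * ‖ι h x‖ * ramp σ ‖ι h x‖ ≤ σ * ‖ι h x‖ * 1 :=
          mul_le_mul_of_nonneg_left (ramp_le_one _ _) (by positivity)
      _ ≤ max ‖ι h x‖ σ ^ 2 := by
        rw [mul_one, sq]
        exact mul_le_mul h2 h1 (norm_nonneg _) (hmax x).le
  have hhk : h * k = (σ : ℂ) • m := by
    have hinj : Function.Injective ι := (AddMonoidHomClass.isometry_of_norm ι hι).injective
    refine hinj (ContinuousMap.ext fun x => ?_)
    rw [map_mul, map_smul, ContinuousMap.mul_apply, ContinuousMap.smul_apply, hmx, hkx, smul_eq_mul]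
    rcases le_total ‖ι h x‖ σ with h' | h'
    · simp [ramp_eq_zero hσ0 h']
    · rw [max_eq_left h', mul_div_assoc']
      have hne : ((‖ι h x‖ : ℝ) : ℂ) ≠ 0 := by exact_mod_cast (hσ0.trans_le h').ne'
      rw [div_eq_iff (pow_ne_zero 2 hne), ← Complex.mul_conj']
      simp only [RCLike.star_def]
      ring
  have hσn : ‖(σ : ℂ)‖ = σ := by rw [Complex.norm_real, Real.norm_of_nonneg hσ0.le]
  have hΦm : ‖Φ m‖ ≤ 1 / 4 := by
    have h1 := hΦ.norm_apply_smul_sub_le (c := σ) (by rw [hσn]; linarith) hm1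
    have h2 := (hΦ.2.2.2 h k hh1 hk1).le
    rw [hhk] at h2
    have h3 : ‖Φ h * Φ k‖ ≤ 2 * ε := by
      rw [norm_mul]
      nlinarith [hΦ.1 k hk1, norm_nonneg (Φ h), norm_nonneg (Φ k)]
    have h4 : ‖σ * Φ m‖ ≤ 4 * ε := by
      have e : σ * Φ m = -(Φ ((σ : ℂ) • m) - σ * Φ m) + ((Φ ((σ : ℂ) • m) - Φ h * Φ k) +
        Φ h * Φ k) := by ring
      rw [e]
      refine (norm_add_le _ _).trans ?_
      rw [norm_neg]
      linarith [norm_add_le (Φ ((σ : ℂ) • m) - Φ h * Φ k) (Φ h * Φ k)]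
    rw [norm_mul, hσn, hσ] at h4
    nlinarith
  have hqm : ‖q * m‖ ≤ 1 := (norm_mul_le _ _).trans (mul_le_one₀ hq1 (norm_nonneg _) hm1)
  have hr (x) : ι (q - q * m) x = ι q x * ((1 - ramp σ ‖ι h x‖ : ℝ) : ℂ) := by
    rw [map_sub, map_mul, ContinuousMap.sub_apply, ContinuousMap.mul_apply, hmx]
    push_cast
    ring
  have hrn (x) : ‖ι (q - q * m) x‖ ≤ ‖ι q x‖ := by
    rw [hr, norm_mul, Complex.norm_real, Real.norm_of_nonneg (sub_nonneg.2 (ramp_le_one _ _))]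
    exact mul_le_of_le_one_right (norm_nonneg _) (sub_le_self 1 (ramp_nonneg _ _))
  have hr1 : ‖q - q * m‖ ≤ 1 := norm_le_of_gelfand hι zero_le_one fun x =>
    (hrn x).trans ((norm_gelfand_apply_le hι q x).trans hq1)
  have hΦr : 6 / 10 ≤ ‖Φ (q - q * m)‖ := by
    have h1 := hΦ.norm_apply_sub_sub_le hq1 hqm
    have h2 := (hΦ.2.2.2 q m hq1 hm1).le
    have h3 : ‖Φ q * Φ m‖ ≤ 1 / 4 := by
      rw [norm_mul]
      nlinarith [hΦ.1 q hq1, norm_nonneg (Φ q), norm_nonneg (Φ m)]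
    have h4 := norm_sub_norm_le (Φ q - Φ (q * m)) (Φ (q - q * m))
    rw [norm_sub_rev] at h1
    linarith [norm_sub_norm_le (Φ q) (Φ (q * m)), norm_sub_norm_le (Φ (q * m)) (Φ q * Φ m)]
  refine (hΦ.isLarge_of_le hι hp hs (τ := 1 / 10) (by norm_num) (by norm_num) (by linarith)
    hr1 (by linarith)).mono fun x (hx : 1 / 10 < ‖ι (q - q * m) x‖) => ?_
  have h1 : 1 / 10 < ‖ι q x‖ := hx.trans_le (hrn x)
  have h2 : ‖ι h x‖ < 2 * σ := by
    by_contra! h'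
    rw [hr, ramp_eq_one hσ0 h'] at hx
    norm_num at hx
  rw [hhx, norm_div, norm_mul] at h2
  change ‖ι f x - Φ f‖ ≤ 640 * ε
  norm_num at h2
  nlinarith [norm_nonneg (ι f x - Φ f)]

/-- An approximate character is close to evaluation at a point of the compactified spectrum. -/
theorem EpsStarHom.exists_norm_sub_le (hΦ : EpsStarHom ε Φ) (hι : ∀ a, ‖ι a‖ = ‖a‖)
    (hp : ∀ a, ι a p = 0) (hs : ∀ f : C(X, ℂ), f p = 0 → ∃ a, ι a = f) (hε0 : 0 < ε)
    (hε : ε ≤ 1 / 100) : ∃ x, ∀ a, ‖a‖ ≤ 1 → ‖ι a x - Φ a‖ ≤ 640 * ε := by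
  by_cases hsmall : ∀ a, ‖a‖ ≤ 1 → ‖Φ a‖ ≤ 640 * ε
  · exact ⟨p, fun a ha => by simpa [hp] using hsmall a ha⟩
  push Not at hsmall
  obtain ⟨a, ha, hΦa⟩ := hsmall
  have huniv : IsLarge ι Φ Set.univ :=
    (hΦ.isLarge_of_le hι hp hs (τ := 10 * ε) (by positivity) (by linarith) le_rfl ha
      (by linarith)).mono (Set.subset_univ _)
  have hfin (u : Finset {a : A // ‖a‖ ≤ 1}) :
      IsLarge ι Φ (⋂ f ∈ u, {x | ‖ι f.1 x - Φ f.1‖ ≤ 640 * ε}) := by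
    classical
    induction u using Finset.induction with
    | empty => simpa using huniv
    | insert f u _ ih =>
      rw [Finset.set_biInter_insert]
      exact hΦ.isLarge_inter hι hp hs hε
        (hΦ.isLarge_norm_sub_le hι hp hs hε0 hε huniv f.2) ih
  obtain ⟨x, hx⟩ := CompactSpace.iInter_nonempty
    (t := fun f : {a : A // ‖a‖ ≤ 1} => {x | ‖ι f.1 x - Φ f.1‖ ≤ 640 * ε})
    (fun f => isClosed_le (by fun_prop) continuous_const)
    (fun u => hΦ.nonempty_of_isLarge hι hε (hfin u))
  exact ⟨x, fun a ha => Set.mem_iInter.1 hx ⟨a, ha⟩⟩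

end ApproxCharacter

section Dual

variable {A B : Type*} [NonUnitalCommCStarAlgebra A] [NonUnitalCommCStarAlgebra B]
  {X Y : Type*} [TopologicalSpace X] [TopologicalSpace Y]
  [CompactSpace Y] {p : X} {q : Y} {ι : A →⋆ₙₐ[ℂ] C(X, ℂ)} {κ : B →⋆ₙₐ[ℂ] C(Y, ℂ)}
  {ε : ℝ} {φ : A → B}

/-- A continuous map of compactified spectra induces a `*`-homomorphism. -/
theorem exists_starHom_of_continuousMap (hp : ∀ a, ι a p = 0) (hκ : ∀ b, ‖κ b‖ = ‖b‖)
    (hr : ∀ f : C(Y, ℂ), f q = 0 → ∃ b, κ b = f) (θ : C(Y, X)) (hθ : θ q = p) :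
    ∃ ψ : A →⋆ₙₐ[ℂ] B, ∀ a y, κ (ψ a) y = ι a (θ y) := by
  have hinj : Function.Injective κ := (AddMonoidHomClass.isometry_of_norm κ hκ).injective
  choose ψ hψ using fun a => hr ((ι a).comp θ) (by simp [hθ, hp])
  have hψx (a y) : κ (ψ a) y = ι a (θ y) := by rw [hψ]; rfl
  exact ⟨{
    toFun := ψ
    map_smul' := fun c a => hinj <| ContinuousMap.ext fun y => by simp [hψx]
    map_zero' := hinj <| ContinuousMap.ext fun y => by simp [hψx]
    map_add' := fun a b => hinj <| ContinuousMap.ext fun y => by simp [hψx]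
    map_mul' := fun a b => hinj <| ContinuousMap.ext fun y => by simp [hψx]
    map_star' := fun a => hinj <| ContinuousMap.ext fun y => by simp [hψx, map_star] }, hψx⟩

variable [CompactSpace X] [T2Space X]

theorem eq_of_forall_norm_gelfand_sub_lt (hι : ∀ a, ‖ι a‖ = ‖a‖)
    (hs : ∀ f : C(X, ℂ), f p = 0 → ∃ a, ι a = f) {x y : X}
    (h : ∀ a, ‖a‖ ≤ 1 → ‖ι a x - ι a y‖ < 1) : x = y := by
  by_contra hne
  wlog hx : x ≠ p generalizing x y
  · exact this (fun a ha => norm_sub_rev (ι a x) _ ▸ h a ha) (Ne.symm hne)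
      fun hy => hne ((not_not.1 hx).trans hy.symm)
  obtain ⟨f, hf0, hf1, hf⟩ := exists_continuous_zero_one_of_isClosed
    (s := {p, y}) (t := {x}) (Set.toFinite _).isClosed isClosed_singleton
    (by simpa using ⟨hx, hne⟩)
  obtain ⟨a, ha⟩ := hs ⟨fun z => (f z : ℂ), by fun_prop⟩ (by simpa using hf0 (by simp : p ∈ _))
  have hax (z) : ι a z = (f z : ℂ) := by rw [ha]; rfl
  have ha1 : ‖a‖ ≤ 1 := norm_le_of_gelfand hι zero_le_one fun z => by
    rw [hax, Complex.norm_real, Real.norm_of_nonneg (hf z).1]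
    exact (hf z).2
  have := h a ha1
  rw [hax, hax, hf1 rfl, hf0 (by simp)] at this
  simp at this

theorem EpsStarHom.gelfand_apply (hφ : EpsStarHom ε φ) (hκ : ∀ b, ‖κ b‖ = ‖b‖) (y : Y) :
    EpsStarHom ε fun a => κ (φ a) y := by
  have hn := norm_gelfand_apply_le hκ
  refine ⟨fun a ha => (hn _ y).trans (hφ.1 a ha), fun a b ha hb s t hs ht => ?_, fun a ha => ?_,
    fun a b ha hb => ?_⟩
  · simpa using (hn _ y).trans_lt (hφ.2.1 a b ha hb s t hs ht)
  · simpa [map_star] using (hn _ y).trans_lt (hφ.2.2.1 a ha)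
  · simpa using (hn _ y).trans_lt (hφ.2.2.2 a b ha hb)

/-- An approximate `*`-homomorphism between commutative C*-algebras is close to the
`*`-homomorphism dual to a continuous map of compactified spectra. -/
theorem EpsStarHom.exists_continuousMap (hφ : EpsStarHom ε φ) (hι : ∀ a, ‖ι a‖ = ‖a‖)
    (hp : ∀ a, ι a p = 0) (hs : ∀ f : C(X, ℂ), f p = 0 → ∃ a, ι a = f)
    (hκ : ∀ b, ‖κ b‖ = ‖b‖) (hq : ∀ b, κ b q = 0) (hε0 : 0 < ε) (hε : ε ≤ 1 / 2000) :
    ∃ θ : C(Y, X), θ q = p ∧ ∀ a, ‖a‖ ≤ 1 → ∀ y, ‖κ (φ a) y - ι a (θ y)‖ ≤ 640 * ε := by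
  choose θ hθ using fun y =>
    (hφ.gelfand_apply hκ y).exists_norm_sub_le hι hp hs hε0 (by linarith)
  have huniq {x : X} {y : Y} (h : ∀ a, ‖a‖ ≤ 1 → ‖ι a x - κ (φ a) y‖ ≤ 640 * ε) : x = θ y := by
    refine eq_of_forall_norm_gelfand_sub_lt hι hs fun a ha => ?_
    have h1 := hθ y a ha
    rw [norm_sub_rev] at h1
    calc ‖ι a x - ι a (θ y)‖ ≤ ‖ι a x - κ (φ a) y‖ + ‖κ (φ a) y - ι a (θ y)‖ :=
          norm_sub_le_norm_sub_add_norm_sub _ _ _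
      _ < 1 := by linarith [h a ha]
  have hcont : Continuous θ := by
    refine continuous_of_isClosed_graph ?_
    have : {z : Y × X | z.2 = θ z.1} =
        ⋂ (a : A) (_ : ‖a‖ ≤ 1), {z : Y × X | ‖ι a z.2 - κ (φ a) z.1‖ ≤ 640 * ε} := by
      ext z
      simp only [Set.mem_iInter]
      refine ⟨fun hz a ha => ?_, fun h => huniq h⟩
      have hz' : z.2 = θ z.1 := hz
      change ‖ι a z.2 - κ (φ a) z.1‖ ≤ _
      rw [hz']
      exact hθ z.1 a ha
    rw [this]
    exact isClosed_iInter fun a => isClosed_iInter fun _ =>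
      isClosed_le (by fun_prop) continuous_const
  exact ⟨⟨θ, hcont⟩, (huniq fun a ha => by simp [hp, hq, hε0.le]).symm,
    fun a ha y => norm_sub_rev (ι a (θ y)) _ ▸ hθ y a ha⟩

end Dual

/-- For small `ε`, an approximate `*`-homomorphism between commutative C*-algebras is close to a
`*`-homomorphism, with a linear estimate. -/
theorem EpsStarHom.exists_starHom_norm_sub_le {A B : Type} [NonUnitalCommCStarAlgebra A]
    [NonUnitalCommCStarAlgebra B] {ε : ℝ} {φ : A → B} (hφ : EpsStarHom ε φ) (hε0 : 0 < ε)
    (hε : ε ≤ 1 / 2000) :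
    ∃ ψ : A →⋆ₙₐ[ℂ] B, ∀ x : A, ‖x‖ ≤ 1 → ‖φ x - ψ x‖ ≤ 640 * ε := by
  obtain ⟨X, _, _, _, p, ι, hι, hp, hs⟩ := exists_gelfand_model A
  obtain ⟨Y, _, _, _, q, κ, hκ, hq, hr⟩ := exists_gelfand_model B
  obtain ⟨θ, hθ, h⟩ := hφ.exists_continuousMap hι hp hs hκ hq hε0 hε
  obtain ⟨ψ, hψ⟩ := exists_starHom_of_continuousMap hp hκ hr θ hθ
  refine ⟨ψ, fun a ha => norm_le_of_gelfand hκ (by positivity) fun y => ?_⟩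
  rw [map_sub, ContinuousMap.sub_apply, hψ]
  exact h a ha y

/-- A `*`-homomorphism close to an approximate isomorphism is bijective. -/
theorem EpsIsomorphism.bijective_of_norm_sub_le {A B : Type*} [NonUnitalCStarAlgebra A]
    [NonUnitalCStarAlgebra B] {ε δ : ℝ} {φ : A → B} (hφ : EpsIsomorphism ε φ)
    (hδ : ε + δ < 1 / 2) {ψ : A →⋆ₙₐ[ℂ] B}
    (h : ∀ x : A, ‖x‖ ≤ 1 → ‖φ x - ψ x‖ ≤ δ) : Function.Bijective ψ := by
  have hinj : Function.Injective ψ := by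
    refine (injective_iff_map_eq_zero ψ).2 fun a ha => ?_
    by_contra hne
    have hn : ‖((‖a‖⁻¹ : ℝ) : ℂ) • a‖ = 1 := by
      simpa using norm_smul_inv_norm (𝕜 := ℂ) hne
    have h1 := h _ hn.le
    have h2 := (abs_lt.1 (hφ.1.2 _ hn.le)).2
    rw [map_smul, ha, smul_zero, sub_zero] at h1
    linarith
  refine ⟨hinj, ?_⟩
  have hclosed : IsClosed (LinearMap.range (ψ : A →ₗ[ℂ] B) : Set B) := by
    have := (NonUnitalStarAlgHom.isometry ψ hinj).isClosedEmbedding.isClosed_range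
    simpa using! this
  by_contra hsurj
  obtain ⟨b, hb⟩ : ∃ b, b ∉ LinearMap.range (ψ : A →ₗ[ℂ] B) := by
    by_contra! hall
    exact hsurj fun b => hall b
  obtain ⟨c, -, hc1, hc⟩ := riesz_lemma_of_lt_one hclosed ⟨b, hb⟩ (r := 1 / 2) (by norm_num)
  obtain ⟨x, hx, hcx⟩ := hφ.2 c hc1.le
  have h1 := hc (ψ x) ⟨x, rfl⟩
  linarith [norm_sub_le_norm_sub_add_norm_sub c (φ x) (ψ x), h x hx]

/-- **(Stability of `ε`-`*`-homomorphisms on separable commutative C*-algebras.)**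
There is a constant `K > 0` such that for every `0 < ε < 1/4`, all separable commutative
C*-algebras `A` and `B` and every `ε`-`*`-homomorphism `φ : A → B`, there is a genuine
`*`-homomorphism `ψ : A → B` with `‖φ x - ψ x‖ < K·√ε` on the unit ball.  Moreover there is
`ε₀ > 0` such that if in addition `ε < ε₀` and `φ` is an `ε`-isomorphism, then `ψ` may be
chosen to be a `*`-isomorphism of `A` onto `B`. -/
theorem exists_starHom_near_epsStarHom_commutative :
    ∃ K : ℝ, 0 < K ∧ ∃ ε₀ : ℝ, 0 < ε₀ ∧
      ∀ (A B : Type) [NonUnitalCommCStarAlgebra A] [NonUnitalCommCStarAlgebra B]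
        [TopologicalSpace.SeparableSpace A] [TopologicalSpace.SeparableSpace B]
        (ε : ℝ), 0 < ε → ε < 1 / 4 →
        ∀ φ : A → B, EpsStarHom ε φ →
          (∃ ψ : A →⋆ₙₐ[ℂ] B, ∀ x : A, ‖x‖ ≤ 1 → ‖φ x - ψ x‖ < K * Real.sqrt ε) ∧
          (ε < ε₀ → EpsIsomorphism ε φ →
            ∃ ψ : A →⋆ₙₐ[ℂ] B, Function.Bijective ψ ∧
              ∀ x : A, ‖x‖ ≤ 1 → ‖φ x - ψ x‖ < K * Real.sqrt ε) := by
  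
  refine ⟨641, by norm_num, 1 / 2000, by norm_num, fun A B _ _ _ _ ε hε0 hε φ hφ => ?_⟩
  have hlt : 640 * ε < 641 * √ε := by
    have h1 : 0 < √ε := Real.sqrt_pos.2 hε0
    nlinarith [Real.sq_sqrt hε0.le, Real.sqrt_le_one.2 (by linarith : ε ≤ 1)]
  refine ⟨?_, fun hε' hiso => ?_⟩
  · rcases le_total ε (1 / 2000) with hε' | hε'
    · obtain ⟨ψ, hψ⟩ := hφ.exists_starHom_norm_sub_le hε0 hε'
      exact ⟨ψ, fun x hx => (hψ x hx).trans_lt hlt⟩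
    · refine ⟨0, fun x hx => ?_⟩
      have h1 : 1 / 100 ≤ √ε := Real.le_sqrt_of_sq_le (by linarith)
      rw [NonUnitalStarAlgHom.zero_apply, sub_zero]
      linarith [hφ.1 x hx]
  · obtain ⟨ψ, hψ⟩ := hφ.exists_starHom_norm_sub_le hε0 hε'.le
    exact ⟨ψ, hiso.bijective_of_norm_sub_le (by linarith) hψ,
      fun x hx => (hψ x hx).trans_lt hlt⟩
end

section
/- There is ε₀ > 0 such that for every ε with 0 < ε < ε₀ the following holds: if A is a unital separable C*-algebra which is approximately finite-dimensional (AF), B is any C*-algebra, and there is an ε-isomorphism from A to B, then A and B are *-isomorphic. -/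
/-- A unital C*-algebra is approximately finite-dimensional (AF) if it has an increasing
sequence of finite-dimensional `*`-subalgebras whose union is dense. -/
def IsAF (A : Type*) [CStarAlgebra A] : Prop :=
  ∃ S : ℕ → NonUnitalStarSubalgebra ℂ A, Monotone S ∧
    (∀ n, FiniteDimensional ℂ (S n)) ∧ Dense (⋃ n, (S n : Set A))

/-- A left-invariant averaging operator on the continuous functions from a topological group
to a C*-algebra. -/
structure InvariantMean (G B : Type*) [Group G] [TopologicalSpace G] [ContinuousMul G]
    [CompactSpace G] [CStarAlgebra B] where
  toLinearMap : C(G, B) →ₗ[ℂ] B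
  map_const : ∀ b, toLinearMap (.const G b) = b
  norm_le : ∀ f, ‖toLinearMap f‖ ≤ ‖f‖
  map_const_mul : ∀ b f, toLinearMap (.const G b * f) = b * toLinearMap f
  map_mul_const : ∀ b f, toLinearMap (f * .const G b) = toLinearMap f * b
  map_star : ∀ f, toLinearMap (star f) = star (toLinearMap f)
  map_translate : ∀ f h, toLinearMap (f.comp (ContinuousMap.mulLeft h)) = toLinearMap f

open MeasureTheory in
theorem InvariantMean.nonempty (G B : Type*) [Group G] [TopologicalSpace G]
    [IsTopologicalGroup G] [CompactSpace G] [CStarAlgebra B] : Nonempty (InvariantMean G B) := by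
  borelize G
  let μ : Measure G := Measure.haarMeasure ⊤
  have hμ : IsProbabilityMeasure μ := ⟨by
    have := Measure.haarMeasure_self (K₀ := (⊤ : TopologicalSpace.PositiveCompacts G))
    simpa using this⟩
  have hint (f : C(G, B)) : Integrable f μ :=
    f.continuous.integrable_of_hasCompactSupport (HasCompactSupport.of_compactSpace _)
  refine ⟨⟨{ toFun := fun f => ∫ x, f x ∂μ, map_add' := ?_, map_smul' := ?_ }, ?_, ?_, ?_, ?_, ?_,
    ?_⟩⟩
  · intro f g
    exact integral_add (hint f) (hint g)
  · intro c f
    exact integral_smul c _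
  · intro b
    simp
  · intro f
    refine (norm_integral_le_of_norm_le_const (C := ‖f‖)
      (Filter.Eventually.of_forall fun x => f.norm_coe_le_norm x)).trans ?_
    simp
  · intro b f
    exact (ContinuousLinearMap.mul ℂ B b).integral_comp_comm (hint f)
  · intro b f
    exact ((ContinuousLinearMap.mul ℂ B).flip b).integral_comp_comm (hint f)
  · intro f
    exact ((starL' ℝ : B ≃L[ℝ] B) : B →L[ℝ] B).integral_comp_comm (hint f)
  · intro f h
    exact integral_mul_left_eq_self (μ := μ) f h

theorem exists_polar {B : Type*} [CStarAlgebra B] (y : B) {η : ℝ} (hη : η ≤ 1 / 2)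
    (h₁ : ‖1 - star y * y‖ ≤ η) (h₂ : ‖1 - y * star y‖ ≤ η) :
    ∃ k : B, y * k ∈ unitary B ∧ ‖y * k - y‖ ≤ η ∧
      ∀ z, Commute z (star y * y) → Commute z k := by
  have h0 : 0 ≤ η := (norm_nonneg _).trans h₁
  set a := star y * y with ha_def
  have ha : IsSelfAdjoint a := .star_mul_self y
  have hspec : ∀ t ∈ spectrum ℝ a, |1 - t| ≤ η := by
    intro t ht
    have := norm_apply_le_norm_cfc (fun t : ℝ => 1 - t) a ht
    rw [cfc_sub .., cfc_id' .., cfc_const_one ..] at this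
    exact this.trans h₁
  have hpos : ∀ t ∈ spectrum ℝ a, 0 < t := fun t ht => by
    have := abs_le.1 (hspec t ht); linarith
  obtain ⟨f, hf⟩ : ∃ f : ℝ → ℝ, f = fun t : ℝ => (√t)⁻¹ := ⟨_, rfl⟩
  have hcont : ContinuousOn f (spectrum ℝ a) := hf ▸
    Real.continuous_sqrt.continuousOn.inv₀ fun t ht => (Real.sqrt_pos.2 (hpos t ht)).ne'
  set k := cfc f a with hk_def
  have hk : IsSelfAdjoint k := cfc_predicate _ _
  have hcomm : ∀ z, Commute z a → Commute z k := fun z hz => (hz.symm.cfc_real _).symm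
  have hkak : k * a * k = 1 := by
    nth_rw 1 [← cfc_id' ℝ a]
    rw [hk_def, ← cfc_mul f _ a hcont, ← cfc_mul (fun t => f t * t) f a (hcont.mul continuousOn_id)
      hcont, ← cfc_const_one ℝ a]
    refine cfc_congr fun t ht => ?_
    subst hf
    have := Real.sqrt_pos.2 (hpos t ht)
    have h2 := Real.mul_self_sqrt (hpos t ht).le
    simp only
    field_simp
    nlinarith
  have hu1 : star (y * k) * (y * k) = 1 := by
    rw [star_mul, hk.star_eq, ← hkak, ha_def]; simp only [mul_assoc]
  have hunit : IsUnit y := by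
    have e1 : IsUnit (star y * y) := by
      have := isUnit_one_sub_of_norm_lt_one (x := 1 - star y * y) (by linarith)
      simpa using this
    have e2 : IsUnit (y * star y) := by
      have := isUnit_one_sub_of_norm_lt_one (x := 1 - y * star y) (by linarith)
      simpa using this
    obtain ⟨c, hc⟩ := e1.exists_left_inv
    obtain ⟨d, hd⟩ := e2.exists_right_inv
    exact isUnit_iff_exists_and_exists.2
      ⟨⟨star y * d, by rw [← mul_assoc, hd]⟩, ⟨c * star y, by rw [mul_assoc, hc]⟩⟩
  have hkunit : IsUnit k := by
    have hak : a * k = k * a := ((Commute.refl a).symm.cfc_real _).symm.eq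
    refine isUnit_iff_exists_and_exists.2 ⟨⟨a * k, by rw [← mul_assoc, hkak]⟩, ⟨k * a, hkak⟩⟩
  have hu : y * k ∈ unitary B := (hunit.mul hkunit).mem_unitary_of_star_mul_self hu1
  refine ⟨k, hu, ?_, hcomm⟩
  have hy : y * k - y = y * k * cfc (fun t : ℝ => 1 - √t) a := by
    have : k * cfc (fun t : ℝ => 1 - √t) a = k - 1 := by
      rw [hk_def, ← cfc_mul f _ a hcont, ← cfc_const_one ℝ a, ← cfc_sub f _ a hcont]
      refine cfc_congr fun t ht => ?_
      subst hf
      have := Real.sqrt_pos.2 (hpos t ht)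
      simp only
      field_simp
    rw [mul_assoc, this, mul_sub, mul_one]
  rw [hy, CStarRing.norm_mem_unitary_mul _ hu]
  refine norm_cfc_le h0 fun t ht => (?_ : |1 - √t| ≤ η).trans' le_rfl
  have h3 := hspec t ht
  have h4 : 1 - t = (1 - √t) * (1 + √t) := by
    have := Real.mul_self_sqrt (hpos t ht).le; nlinarith
  rw [h4, abs_mul] at h3
  have : 1 ≤ |1 + √t| := by rw [abs_of_nonneg (by positivity)]; linarith [Real.sqrt_nonneg t]
  nlinarith [abs_nonneg (1 - √t)]


theorem ContinuousMap.mem_unitary_iff {X B : Type*} [TopologicalSpace X] [CStarAlgebra B]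
    {f : C(X, B)} :
    f ∈ unitary C(X, B) ↔ ∀ x, f x ∈ unitary B := by
  simp only [Unitary.mem_iff, ContinuousMap.ext_iff, ← forall_and]
  rfl

section averaging

variable {G B : Type*} [Group G] [TopologicalSpace G] [IsTopologicalGroup G] [CompactSpace G]
  [CStarAlgebra B]

theorem InvariantMean.norm_map_sub_le (M : InvariantMean G B) {f : C(G, B)} {c : B} {e : ℝ}
    (h : ‖f - .const G c‖ ≤ e) : ‖M.toLinearMap f - c‖ ≤ e := by
  nth_rw 1 [← M.map_const c, ← map_sub]
  exact (M.norm_le _).trans h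

theorem InvariantMean.norm_map_mul_sub_le (M : InvariantMean G B) {f f' : C(G, B)} {c d : B}
    {e : ℝ} (hf : ‖f - .const G c‖ ≤ e) (hf' : ‖f' - .const G d‖ ≤ e) :
    ‖M.toLinearMap (f * f') - M.toLinearMap f * M.toLinearMap f'‖ ≤ 2 * e ^ 2 := by
  have he : 0 ≤ e := (norm_nonneg _).trans hf
  have key : M.toLinearMap (f * f') - M.toLinearMap f * M.toLinearMap f' =
      M.toLinearMap ((f - .const G c) * (f' - .const G d)) -
        (M.toLinearMap f - c) * (M.toLinearMap f' - d) := by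
    rw [sub_mul, mul_sub, mul_sub, map_sub, map_sub, map_sub, M.map_mul_const, M.map_const_mul,
      M.map_const_mul, M.map_const]
    noncomm_ring
  rw [key]
  have h1 : ‖M.toLinearMap ((f - .const G c) * (f' - .const G d))‖ ≤ e * e :=
    (M.norm_le _).trans ((norm_mul_le _ _).trans (by gcongr))
  have h2 : ‖(M.toLinearMap f - c) * (M.toLinearMap f' - d)‖ ≤ e * e :=
    (norm_mul_le _ _).trans
      (mul_le_mul (M.norm_map_sub_le hf) (M.norm_map_sub_le hf') (norm_nonneg _) he)
  refine (norm_sub_le _ _).trans ?_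
  linarith

theorem InvariantMean.continuous (M : InvariantMean G B) : Continuous M.toLinearMap :=
  AddMonoidHomClass.continuous_of_bound M.toLinearMap 1 (by simpa using M.norm_le)

theorem norm_le_one_of_mem_unitary {b : B} (hb : b ∈ unitary B) : ‖b‖ ≤ 1 := by
  nontriviality B
  exact (CStarRing.norm_of_mem_unitary hb).le

theorem norm_mul_sub_mul_le {a b a' b' : B} {r s : ℝ} (ha : ‖a'‖ ≤ 1) (hb : ‖b‖ ≤ 1)
    (hr : ‖a - a'‖ ≤ r) (hs : ‖b - b'‖ ≤ s) : ‖a * b - a' * b'‖ ≤ r + s := by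
  have : a * b - a' * b' = (a - a') * b + a' * (b - b') := by noncomm_ring
  rw [this]
  refine (norm_add_le _ _).trans (add_le_add ?_ ?_)
  · exact (norm_mul_le _ _).trans
      ((mul_le_of_le_one_right (norm_nonneg _) hb).trans hr)
  · exact (norm_mul_le _ _).trans
      ((mul_le_of_le_one_left (norm_nonneg _) ha).trans hs)

theorem exists_unitary_defect_halved (ρ : C(G, B)) (hρ : ρ ∈ unitary C(G, B)) {e : ℝ}
    (he : e ≤ 1 / 16) (h : ∀ g h, ‖ρ (g * h) - ρ g * ρ h‖ ≤ e) :
    ∃ ρ' ∈ unitary C(G, B), (∀ g h, ‖ρ' (g * h) - ρ' g * ρ' h‖ ≤ e / 2) ∧ ‖ρ' - ρ‖ ≤ 2 * e := by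
  obtain ⟨M⟩ := InvariantMean.nonempty G B
  have he0 : 0 ≤ e := (norm_nonneg _).trans (h 1 1)
  have hu := ContinuousMap.mem_unitary_iff.1 hρ
  let a : C(G, C(G, B)) := ContinuousMap.curry
    ⟨fun p : G × G => ρ (p.1 * p.2) * star (ρ p.2), by fun_prop⟩
  have ha (g x : G) : a g x = ρ (g * x) * star (ρ x) := rfl
  have hae (g : G) : ‖a g - .const G (ρ g)‖ ≤ e := by
    refine (ContinuousMap.norm_le _ he0).2 fun x => ?_
    have : (a g - .const G (ρ g)) x = (ρ (g * x) - ρ g * ρ x) * star (ρ x) := by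
      simp [ha, sub_mul, mul_assoc, Unitary.mul_star_self_of_mem (hu x)]
    rw [this, CStarRing.norm_mul_mem_unitary _ (Unitary.star_mem (hu x))]
    exact h g x
  have hae' (g : G) : ‖star (a g) - .const G (star (ρ g))‖ ≤ e := by
    have : star (a g) - .const G (star (ρ g)) = star (a g - .const G (ρ g)) := by
      ext; simp
    rw [this, norm_star]
    exact hae g
  have haa (g : G) : a g ∈ unitary C(G, B) := ContinuousMap.mem_unitary_iff.2 fun x =>
    mul_mem (hu _) (Unitary.star_mem (hu _))
  let r : C(G, B) := ⟨fun g => M.toLinearMap (a g), M.continuous.comp a.continuous⟩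
  have hr (g : G) : r g = M.toLinearMap (a g) := rfl
  have hrρ (g : G) : ‖r g - ρ g‖ ≤ e := M.norm_map_sub_le (hae g)
  have hr1 (g : G) : ‖r g‖ ≤ 1 := (M.norm_le _).trans (norm_le_one_of_mem_unitary (haa g))
  have hrr (g h : G) : ‖r (g * h) - r g * r h‖ ≤ 2 * e ^ 2 := by
    have h1 : r g = M.toLinearMap ((a g).comp (ContinuousMap.mulLeft h)) :=
      (M.map_translate _ _).symm
    have h2 : a (g * h) = (a g).comp (ContinuousMap.mulLeft h) * a h := by
      ext x
      simp only [ha, ContinuousMap.mul_apply, ContinuousMap.comp_apply,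
        ContinuousMap.coe_mulLeft]
      rw [mul_assoc (ρ _), ← mul_assoc (star _), Unitary.star_mul_self_of_mem (hu _), one_mul,
        mul_assoc g]
    rw [hr (g * h), h2, h1, hr h]
    refine M.norm_map_mul_sub_le (c := ρ g) (d := ρ h) ?_ (hae h)
    refine (ContinuousMap.norm_le _ he0).2 fun x => ?_
    have := ContinuousMap.norm_coe_le_norm (a g - .const G (ρ g)) (h * x)
    simp only [ContinuousMap.sub_apply, ContinuousMap.comp_apply, ContinuousMap.coe_mulLeft,
      ContinuousMap.const_apply] at this ⊢
    exact this.trans (hae g)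
  have hq : 2 * e ^ 2 ≤ e / 8 := by nlinarith
  have hη : 2 * e ^ 2 ≤ 1 / 2 := by linarith
  obtain ⟨k, hk, hkr, -⟩ := exists_polar r hη
    (by
      refine (ContinuousMap.norm_le _ (by positivity)).2 fun g => ?_
      have := M.norm_map_mul_sub_le (hae' g) (hae g)
      rw [Unitary.star_mul_self_of_mem (haa g), M.map_star] at this
      rwa [show (1 : C(G, B)) = .const G 1 from rfl, M.map_const] at this)
    (by
      refine (ContinuousMap.norm_le _ (by positivity)).2 fun g => ?_
      have := M.norm_map_mul_sub_le (hae g) (hae' g)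
      rw [Unitary.mul_star_self_of_mem (haa g), M.map_star] at this
      rwa [show (1 : C(G, B)) = .const G 1 from rfl, M.map_const] at this)
  have hkr' (g : G) : ‖(r * k) g - r g‖ ≤ 2 * e ^ 2 :=
    (ContinuousMap.norm_coe_le_norm (r * k - r) g).trans hkr
  refine ⟨r * k, hk, fun g h => ?_, ?_⟩
  · have h1 := norm_mul_sub_mul_le (norm_le_one_of_mem_unitary
      (ContinuousMap.mem_unitary_iff.1 hk g)) (hr1 h) ((norm_sub_rev _ _).trans_le (hkr' g))
      ((norm_sub_rev _ _).trans_le (hkr' h))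
    have h2 := norm_sub_le_norm_sub_add_norm_sub ((r * k) (g * h)) (r (g * h))
      ((r * k) g * (r * k) h)
    have h3 := norm_sub_le_norm_sub_add_norm_sub (r (g * h)) (r g * r h)
      ((r * k) g * (r * k) h)
    linarith [hkr' (g * h), hrr g h]
  · refine (ContinuousMap.norm_le _ (by positivity)).2 fun g => ?_
    have h2 := norm_sub_le_norm_sub_add_norm_sub ((r * k) g) (r g) (ρ g)
    have h3 := hkr' g
    have h4 := hrρ g
    rw [ContinuousMap.sub_apply]
    linarith

/-- An approximately multiplicative unitary-valued function on a compact group is close to a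
unitary representation. -/
theorem exists_monoidHom_unitary_near (ρ : C(G, B)) (hρ : ρ ∈ unitary C(G, B)) {e : ℝ}
    (he : e ≤ 1 / 16) (h : ∀ g h, ‖ρ (g * h) - ρ g * ρ h‖ ≤ e) :
    ∃ π : G →* unitary B, ∀ g, ‖(π g : B) - ρ g‖ ≤ 4 * e := by
  have he0 : 0 ≤ e := (norm_nonneg _).trans (h 1 1)
  let X (n : ℕ) := {σ : C(G, B) // σ ∈ unitary C(G, B) ∧
    ∀ g h, ‖σ (g * h) - σ g * σ h‖ ≤ e / 2 ^ n}
  have step (n : ℕ) (σ : X n) : ∃ τ : X (n + 1), ‖τ.1 - σ.1‖ ≤ 2 * (e / 2 ^ n) := by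
    have h1 : e / 2 ^ n ≤ e := div_le_self he0 (one_le_pow₀ one_le_two)
    obtain ⟨τ, hτ, h2, h3⟩ := exists_unitary_defect_halved σ.1 σ.2.1 (h1.trans he) σ.2.2
    exact ⟨⟨τ, hτ, fun g h => (h2 g h).trans_eq (by rw [pow_succ, div_div])⟩, h3⟩
  choose next hnext using step
  let s (n : ℕ) : X n := Nat.rec ⟨ρ, hρ, by simpa using h⟩ (fun n σ => next n σ) n
  have hs (n : ℕ) : dist (s n).1 (s (n + 1)).1 ≤ 4 * e / 2 / 2 ^ n := by
    rw [dist_comm, dist_eq_norm]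
    exact (hnext n (s n)).trans_eq (by ring)
  obtain ⟨σ, hσ⟩ := cauchySeq_tendsto_of_complete (cauchySeq_of_le_geometric_two hs)
  have hd : dist ρ σ ≤ 4 * e := dist_le_of_le_geometric_two_of_tendsto₀ hs hσ
  have hev (g : G) : Filter.Tendsto (fun n => (s n).1 g) Filter.atTop (nhds (σ g)) :=
    ((continuous_eval_const g).tendsto σ).comp hσ
  have hσu : ∀ g, σ g ∈ unitary B := fun g => isClosed_unitary.mem_of_tendsto (hev g)
    (Filter.Eventually.of_forall fun n => ContinuousMap.mem_unitary_iff.1 (s n).2.1 g)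
  have hmul (g h : G) : σ (g * h) = σ g * σ h := by
    rw [← sub_eq_zero, ← norm_le_zero_iff]
    have h0 : Filter.Tendsto (fun n : ℕ => e / 2 ^ n) Filter.atTop (nhds 0) := by
      simpa [div_eq_mul_inv] using
        (tendsto_pow_atTop_nhds_zero_of_lt_one (r := (2⁻¹ : ℝ)) (by norm_num)
          (by norm_num)).const_mul e
    exact le_of_tendsto_of_tendsto' ((hev (g * h)).sub ((hev g).mul (hev h))).norm h0
      fun n => (s n).2.2 g h
  refine ⟨MonoidHom.mk' (fun g => ⟨σ g, hσu g⟩) fun g h => Subtype.ext (hmul g h), fun g => ?_⟩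
  rw [norm_sub_rev]
  exact (ContinuousMap.norm_coe_le_norm (ρ - σ) g).trans (dist_eq_norm ρ σ ▸ hd)

end averaging

theorem EpsStarHom.norm_sub_le {A B : Type*} [NonUnitalCStarAlgebra A] [NonUnitalCStarAlgebra B]
    {φ : A → B} {ε : ℝ} (h : EpsStarHom ε φ) {x y : A} (hx : ‖x‖ ≤ 1) (hy : ‖y‖ ≤ 1) {η : ℝ}
    (hη0 : 0 < η) (hη : η ≤ 1) (hxy : ‖x - y‖ ≤ η) : ‖φ x - φ y‖ ≤ η + 2 * ε := by
  obtain ⟨hc, hl, -, -⟩ := h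
  have hz : ‖((η⁻¹ : ℝ) : ℂ) • (x - y)‖ ≤ 1 := by
    rw [norm_smul, Complex.norm_real, norm_inv, Real.norm_of_nonneg hη0.le]
    exact inv_mul_le_one_of_le₀ hxy hη0.le
  have h1 := hl x y hx hy 1 (-1) (by simp) (by simp)
  have h2 := hl _ 0 hz (by simp) (η : ℂ) 0 (by simpa [abs_of_pos hη0] using hη) (by simp)
  rw [smul_zero, add_zero, smul_smul, ← Complex.ofReal_mul, mul_inv_cancel₀ hη0.ne', zero_smul,
    add_zero, Complex.ofReal_one, one_smul] at h2
  rw [one_smul, one_smul, neg_smul, neg_smul, one_smul, one_smul, ← sub_eq_add_neg,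
    ← sub_eq_add_neg] at h1
  have h3 : ‖(η : ℂ) • φ (((η⁻¹ : ℝ) : ℂ) • (x - y))‖ ≤ η := by
    rw [norm_smul, Complex.norm_real, Real.norm_of_nonneg hη0.le]
    exact mul_le_of_le_one_right hη0.le (hc _ hz)
  have h4 := norm_sub_le_norm_sub_add_norm_sub (φ x - φ y) (φ (x - y)) 0
  have h5 := norm_sub_le_norm_sub_add_norm_sub (φ (x - y))
    ((η : ℂ) • φ (((η⁻¹ : ℝ) : ℂ) • (x - y))) 0
  rw [sub_zero, sub_zero] at h4 h5
  rw [norm_sub_rev] at h1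
  linarith

instance unitary.compactSpace {F : Type*} [CStarAlgebra F] [FiniteDimensional ℂ F] :
    CompactSpace (unitary F) := by
  have := FiniteDimensional.proper ℂ F
  refine isCompact_iff_compactSpace.1 (Metric.isCompact_of_isClosed_isBounded isClosed_unitary ?_)
  exact isBounded_iff_forall_norm_le.2 ⟨1, fun x hx => norm_le_one_of_mem_unitary hx⟩

section near

variable {F B : Type*} [CStarAlgebra F] [FiniteDimensional ℂ F] [CStarAlgebra B] {φ : F → B}
  {ε : ℝ}

/-- An approximate `*`-homomorphism on a finite-dimensional algebra is close, on the unitary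
group, to a representation of that group. -/
theorem EpsStarHom.exists_monoidHom_unitary_near (h : EpsStarHom ε φ) (hε0 : 0 < ε)
    (hε : ε ≤ 1 / 1000) (h1 : ‖φ 1 - 1‖ ≤ 3 * ε) :
    ∃ π : unitary F →* unitary B, ∀ u : unitary F, ‖(π u : B) - φ u‖ ≤ 240 * ε := by
  have hb (u : unitary F) : ‖(u : F)‖ ≤ 1 := norm_le_one_of_mem_unitary u.2
  obtain ⟨f, hf⟩ : ∃ f : C(unitary F, B), ∀ u : unitary F,
      f u ∈ Metric.ball (φ u) (4 * ε) := by
    refine exists_continuous_forall_mem_convex_of_local_const (fun u => convex_ball _ _)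
      fun u => ⟨φ u, ?_⟩
    filter_upwards [Metric.ball_mem_nhds u hε0] with v hv
    rw [Metric.mem_ball, dist_eq_norm, norm_sub_rev]
    have := h.norm_sub_le (hb v) (hb u) hε0 (by linarith)
      (by rw [← dist_eq_norm]; exact (Metric.mem_ball.1 hv).le)
    linarith
  have hf' (u : unitary F) : ‖f u - φ u‖ ≤ 4 * ε := by
    rw [← dist_eq_norm]; exact (Metric.mem_ball.1 (hf u)).le
  obtain ⟨hc, hl, hs, hm⟩ := h
  have hφs (u : unitary F) : ‖φ (star u : unitary F) - star (φ u)‖ ≤ ε := (hs u (hb u)).le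
  have hfs (u : unitary F) : ‖star (f u) - star (φ u)‖ ≤ 4 * ε := by
    rw [← star_sub, norm_star]; exact hf' u
  have hfn (u : unitary F) : ‖f u‖ ≤ 1 + 4 * ε := by
    have := norm_le_norm_add_norm_sub' (f u) (φ u)
    linarith [hf' u, hc _ (hb u)]
  have key (a b a' b' c' d' : B) (ha : ‖a - a'‖ ≤ 4 * ε) (hb : ‖b - b'‖ ≤ 4 * ε)
      (hbn : ‖b‖ ≤ 1 + 4 * ε) (ha' : ‖a'‖ ≤ 1) (hc' : ‖c' * d' - φ 1‖ ≤ ε)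
      (hd' : ‖a' * b' - c' * d'‖ ≤ ε) : ‖1 - a * b‖ ≤ 14 * ε := by
    have e : 1 - a * b = -((φ 1 - 1) + (c' * d' - φ 1) + (a' * b' - c' * d') + (a - a') * b
        + a' * (b - b')) := by noncomm_ring
    have i1 : ‖(a - a') * b‖ ≤ (4 * ε) * (1 + 4 * ε) :=
      (norm_mul_le _ _).trans (by gcongr)
    have i2 : ‖a' * (b - b')‖ ≤ 4 * ε :=
      (norm_mul_le _ _).trans ((mul_le_of_le_one_left (norm_nonneg _) ha').trans hb)
    rw [e, norm_neg]
    refine (norm_add_le_of_le (norm_add_le_of_le (norm_add_le_of_le (norm_add_le_of_le h1 hc') hd')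
      i1) i2).trans ?_
    nlinarith
  obtain ⟨k, hk, hkf, -⟩ := exists_polar f (η := 14 * ε) (by linarith)
    (by
      refine (ContinuousMap.norm_le _ (by positivity)).2 fun u => ?_
      refine key (star (f u)) (f u) (star (φ u)) (φ u) (φ (star u : unitary F)) (φ u) (hfs u)
        (hf' u) (hfn u) (by rw [norm_star]; exact hc _ (hb u)) ?_ ?_
      · have := (hm (star u : unitary F) u (hb _) (hb _)).le
        rwa [← Submonoid.coe_mul, Unitary.star_mul_self, norm_sub_rev] at this
      · rw [← sub_mul, ← norm_neg, ← neg_mul, neg_sub]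
        exact (norm_mul_le _ _).trans ((mul_le_of_le_one_right (norm_nonneg _)
          (hc _ (hb u))).trans (hφs u)))
    (by
      refine (ContinuousMap.norm_le _ (by positivity)).2 fun u => ?_
      refine key (f u) (star (f u)) (φ u) (star (φ u)) (φ u) (φ (star u : unitary F)) (hf' u)
        (hfs u) (by rw [norm_star]; exact hfn u) (hc _ (hb u)) ?_ ?_
      · have := (hm u (star u : unitary F) (hb _) (hb _)).le
        rwa [← Submonoid.coe_mul, Unitary.mul_star_self, norm_sub_rev] at this
      · rw [← mul_sub]
        refine (norm_mul_le _ _).trans ((mul_le_of_le_one_left (norm_nonneg _)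
          (hc _ (hb u))).trans ?_)
        rw [norm_sub_rev]
        exact hφs u)
  obtain ⟨ρ, hρ⟩ : ∃ ρ, ρ = f * k := ⟨_, rfl⟩
  rw [← hρ] at hk hkf
  have hρφ (u : unitary F) : ‖ρ u - φ u‖ ≤ 18 * ε := by
    have e1 := ContinuousMap.norm_coe_le_norm (ρ - f) u
    rw [ContinuousMap.sub_apply] at e1
    have e2 := norm_sub_le_norm_sub_add_norm_sub (ρ u) (f u) (φ u)
    linarith [hf' u]
  obtain ⟨π, hπ⟩ := _root_.exists_monoidHom_unitary_near ρ hk (e := 55 * ε) (by linarith)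
    fun u v => by
      have e1 := norm_mul_sub_mul_le (norm_le_one_of_mem_unitary
        (ContinuousMap.mem_unitary_iff.1 hk u)) (hc _ (hb v)) ((norm_sub_rev _ _).trans_le (hρφ u))
        ((norm_sub_rev _ _).trans_le (hρφ v))
      have e2 := norm_sub_le_norm_sub_add_norm_sub (ρ (u * v)) (φ (u * v : unitary F)) (ρ u * ρ v)
      have e3 := norm_sub_le_norm_sub_add_norm_sub (φ (u * v : unitary F)) (φ u * φ v) (ρ u * ρ v)
      have e4 := hm u v (hb u) (hb v)
      rw [← Submonoid.coe_mul] at e4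
      linarith [hρφ (u * v)]
  refine ⟨π, fun u => ?_⟩
  have := norm_sub_le_norm_sub_add_norm_sub (π u : B) (ρ u) (φ u)
  linarith [hπ u, hρφ u]

end near

section rigidity

variable {F B : Type*} [CStarAlgebra F] [CStarAlgebra B]

theorem norm_sub_one_le_of_pow_near_one {V : B} (hV : V ∈ unitary B) {N : ℕ} (hN : 0 < N)
    (h : ∀ k < N, ‖V ^ k - 1‖ ≤ 1 / 2) : ‖V - 1‖ ≤ 4 / N := by
  have hN' : (0 : ℝ) < N := by exact_mod_cast hN
  have h1 : ‖∑ k ∈ Finset.range N, (1 - V ^ k)‖ ≤ N * (1 / 2) := by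
    refine (norm_sum_le_of_le _ (n := fun _ => (1 / 2 : ℝ)) fun k hk => ?_).trans_eq
      (by rw [Finset.sum_const, Finset.card_range, nsmul_eq_mul])
    rw [norm_sub_rev]
    exact h k (Finset.mem_range.1 hk)
  have h2 : (N : ℂ) • (V - 1) = (V - 1) * ∑ k ∈ Finset.range N, (1 - V ^ k) + (V ^ N - 1) := by
    rw [Finset.sum_sub_distrib, mul_sub, mul_geom_sum]
    simp [Nat.cast_smul_eq_nsmul, nsmul_eq_mul, (Nat.cast_commute N (V - 1)).eq]
  have h3 : ‖V ^ N - 1‖ ≤ 2 := by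
    refine (norm_sub_le _ _).trans ?_
    linarith [norm_le_one_of_mem_unitary (pow_mem hV N),
      norm_le_one_of_mem_unitary (one_mem (unitary B))]
  have h4 : N * ‖V - 1‖ ≤ ‖V - 1‖ * (N * (1 / 2)) + 2 := by
    calc N * ‖V - 1‖ = ‖(N : ℂ) • (V - 1)‖ := by rw [norm_smul]; simp
      _ ≤ _ := by
        rw [h2]
        exact norm_add_le_of_le ((norm_mul_le _ _).trans (by gcongr)) h3
  rw [le_div_iff₀ hN']
  linarith

theorem eq_one_of_pow_near_one {V : B} (hV : V ∈ unitary B) (h : ∀ k : ℕ, ‖V ^ k - 1‖ ≤ 1 / 2) :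
    V = 1 := by
  rw [← sub_eq_zero, ← norm_le_zero_iff]
  refine ge_of_tendsto (tendsto_const_div_atTop_nhds_zero_nat (4 : ℝ)) ?_
  filter_upwards [Filter.eventually_gt_atTop 0] with n hn
  exact norm_sub_one_le_of_pow_near_one hV hn fun k _ => h k

theorem norm_pow_sub_one_le {u : F} (hu : u ∈ unitary F) (k : ℕ) :
    ‖u ^ k - 1‖ ≤ k * ‖u - 1‖ := by
  induction k with
  | zero => simp
  | succ k ih =>
    have : u ^ (k + 1) - 1 = u ^ k * (u - 1) + (u ^ k - 1) := by rw [pow_succ]; noncomm_ring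
    rw [this]
    refine (norm_add_le_of_le (CStarRing.norm_mem_unitary_mul _ (pow_mem hu k)).le ih).trans ?_
    push_cast
    linarith

theorem norm_map_sub_one_le (π : unitary F →* unitary B)
    (h : ∀ u : unitary F, ‖(u : F) - 1‖ ≤ 1 / 16 → ‖(π u : B) - 1‖ ≤ 1 / 2) (u : unitary F) :
    ‖(π u : B) - 1‖ ≤ 128 * ‖(u : F) - 1‖ := by
  obtain ht | ht := le_or_gt (‖(u : F) - 1‖) (1 / 16)
  swap
  · have : ‖(π u : B) - 1‖ ≤ 1 + 1 := (norm_sub_le _ _).trans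
      (add_le_add (norm_le_one_of_mem_unitary (π u).2) (norm_le_one_of_mem_unitary (one_mem _)))
    linarith
  obtain h0 | h0 := (norm_nonneg ((u : F) - 1)).eq_or_lt
  · have : u = 1 := Subtype.ext (sub_eq_zero.1 (norm_eq_zero.1 h0.symm))
    simp [this]
  set t := ‖(u : F) - 1‖
  have h1 : 1 ≤ 1 / (16 * t) := by rw [le_div_iff₀ (by positivity)]; linarith
  have hN : 0 < ⌊1 / (16 * t)⌋₊ := Nat.floor_pos.2 h1
  have hle := Nat.floor_le (a := 1 / (16 * t)) (by positivity)
  have hlt := Nat.lt_floor_add_one (1 / (16 * t))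
  have hN' : (1 : ℝ) ≤ ⌊1 / (16 * t)⌋₊ := by exact_mod_cast hN
  have := norm_sub_one_le_of_pow_near_one (π u).2 hN fun k hk => by
    have h2 := h (u ^ k) (by
      rw [SubmonoidClass.coe_pow]
      refine (norm_pow_sub_one_le u.2 k).trans ?_
      have : (k : ℝ) ≤ 1 / (16 * t) := le_trans (by exact_mod_cast hk.le) hle
      rw [le_div_iff₀ (by positivity)] at this
      linarith)
    rwa [map_pow, SubmonoidClass.coe_pow] at h2
  refine this.trans ?_
  rw [div_le_iff₀ (by positivity)]
  rw [div_lt_iff₀ (by positivity)] at hlt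
  nlinarith

end rigidity

section rotations

variable {B : Type*} [CStarAlgebra B]

/-- The element acting as the scalar `c` on the range of the idempotent `q`, and as `1` on the
range of its complement. -/
def projRot (q : B) (c : ℂ) : B := 1 + (c - 1) • q

theorem projRot_one (q : B) : projRot q 1 = 1 := by simp [projRot]

theorem projRot_mul {q : B} (hq : IsIdempotentElem q) (c d : ℂ) :
    projRot q c * projRot q d = projRot q (c * d) := by
  simp only [projRot, mul_add, add_mul, one_mul, mul_one, smul_mul_smul_comm, hq.eq]
  module

theorem star_projRot {q : B} (hq : IsSelfAdjoint q) (c : ℂ) :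
    star (projRot q c) = projRot q (star c) := by
  simp [projRot, hq.star_eq]

theorem projRot_mem_unitary {q : B} (hq : IsStarProjection q) (c : Circle) :
    projRot q c ∈ unitary B := by
  have h1 : star (c : ℂ) * c = 1 := by
    rw [Complex.star_def, ← Complex.normSq_eq_conj_mul_self, Circle.normSq_coe, Complex.ofReal_one]
  refine Unitary.mem_iff.2 ⟨?_, ?_⟩
  · rw [star_projRot hq.isSelfAdjoint, projRot_mul hq.isIdempotentElem, h1, projRot_one]
  · rw [star_projRot hq.isSelfAdjoint, projRot_mul hq.isIdempotentElem, mul_comm, h1, projRot_one]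

/-- The one-parameter group of rotations along a projection. -/
def IsStarProjection.rotation {q : B} (hq : IsStarProjection q) : Circle →* unitary B where
  toFun c := ⟨projRot q c, projRot_mem_unitary hq c⟩
  map_one' := Subtype.ext (by simp [projRot_one])
  map_mul' c d := Subtype.ext (by simp [projRot_mul hq.isIdempotentElem])

theorem IsStarProjection.coe_rotation {q : B} (hq : IsStarProjection q) (c : Circle) :
    (hq.rotation c : B) = projRot q c := rfl

theorem projRot_eq_comb (q : B) (c : ℂ) :
    projRot q c = ((1 + c) / 2) • (1 : B) + ((1 - c) / 2) • projRot q (-1) := by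
  simp only [projRot]
  module

theorem hasDerivAt_projRot (q : B) (r : ℝ) :
    HasDerivAt (fun t : ℝ => projRot q (Circle.exp (t * r))) ((r * Complex.I) • q) 0 := by
  have h1 : HasDerivAt (fun t : ℝ => ((Circle.exp (t * r) : Circle) : ℂ)) (r * Complex.I) 0 := by
    simp only [Circle.coe_exp]
    have := (((hasDerivAt_id (0 : ℝ)).mul_const r).ofReal_comp.mul_const Complex.I).cexp
    simpa using this
  exact ((h1.sub_const 1).smul_const q).const_add 1

end rotations

section linearization

variable {F B : Type*} [CStarAlgebra F] [CStarAlgebra B]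

/-- A homomorphism of unitary groups which is, up to a fixed small error, compatible with linear
combinations. -/
structure ApproxLinearHom (π : unitary F →* unitary B) : Prop where
  comb : ∀ (u v w : unitary F) (c d : ℂ), ‖c‖ ≤ 1 → ‖d‖ ≤ 1 → (w : F) = c • (u : F) + d • (v : F) →
    ‖(π w : B) - (c • (π u : B) + d • (π v : B))‖ ≤ 1 / 2
  near : ∀ u : unitary F, ‖(u : F) - 1‖ ≤ 1 / 16 → ‖(π u : B) - 1‖ ≤ 1 / 2

variable (π : unitary F →* unitary B)

open Classical in
/-- The projection corresponding to `q` under a homomorphism of unitary groups. -/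
noncomputable def mapProj (q : F) : B :=
  if hq : IsStarProjection q then (1 / 2 : ℂ) • (1 - (π (hq.rotation (Circle.exp Real.pi)) : B))
  else 0

variable {π}

theorem IsStarProjection.mapProj {q : F} (hq : IsStarProjection q) :
    IsStarProjection (mapProj π q) := by
  have h2 : (π (hq.rotation (Circle.exp Real.pi)) : B) *
      π (hq.rotation (Circle.exp Real.pi)) = 1 := by
    rw [← Submonoid.coe_mul, ← map_mul, ← map_mul, ← Circle.exp_add, ← two_mul,
      Circle.exp_two_pi, map_one, map_one, Submonoid.coe_one]
  have h3 : star (π (hq.rotation (Circle.exp Real.pi)) : B) =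
      π (hq.rotation (Circle.exp Real.pi)) :=
    left_inv_eq_right_inv (Unitary.star_mul_self_of_mem (SetLike.coe_mem _)) h2
  rw [_root_.mapProj, dif_pos hq]
  refine ⟨?_, ?_⟩
  · rw [IsIdempotentElem, smul_mul_smul_comm]
    simp only [sub_mul, mul_sub, h2, one_mul, mul_one]
    module
  · rw [IsSelfAdjoint, star_smul, star_sub, h3]
    simp

theorem ApproxLinearHom.map_rotation (hπ : ApproxLinearHom π) {q : F} (hq : IsStarProjection q)
    (c : Circle) : π (hq.rotation c) = (hq.mapProj (π := π)).rotation c := by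
  rw [← mul_inv_eq_one]
  refine Subtype.ext (eq_one_of_pow_near_one (SetLike.coe_mem _) fun k => ?_)
  have hcomm : Commute (π (hq.rotation c)) ((hq.mapProj (π := π)).rotation c)⁻¹ := by
    refine Commute.inv_right ?_
    have h1 : Commute (π (hq.rotation c)) (π (hq.rotation (Circle.exp Real.pi))) := by
      rw [Commute, SemiconjBy, ← map_mul, ← map_mul, ← map_mul, ← map_mul, mul_comm]
    refine Subtype.ext ?_
    have h2 : Commute (π (hq.rotation c) : B) (π (hq.rotation (Circle.exp Real.pi)) : B) :=
      congrArg Subtype.val h1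
    simp only [Submonoid.coe_mul, IsStarProjection.coe_rotation, projRot, _root_.mapProj,
      dif_pos hq]
    exact (Commute.add_right (Commute.one_right _)
      ((((Commute.one_right _).sub_right h2).smul_right _).smul_right _)).eq
  rw [← SubmonoidClass.coe_pow, hcomm.mul_pow, ← map_pow, ← map_pow, inv_pow, ← map_pow]
  have h3 := hπ.comb 1 (hq.rotation (Circle.exp Real.pi)) (hq.rotation (c ^ k))
    ((1 + (c ^ k : Circle)) / 2) ((1 - (c ^ k : Circle)) / 2) ?_ ?_ ?_
  · have h4 : (((hq.mapProj (π := π)).rotation (c ^ k) : unitary B) : B) =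
      ((1 + (c ^ k : Circle)) / 2 : ℂ) • ((π 1 : unitary B) : B) +
        ((1 - (c ^ k : Circle)) / 2 : ℂ) • (π (hq.rotation (Circle.exp Real.pi)) : B) := by
      rw [IsStarProjection.coe_rotation, map_one, projRot, _root_.mapProj, dif_pos hq]
      simp only [Submonoid.coe_one]
      module
    rw [← h4] at h3
    rw [← CStarRing.norm_mul_coe_unitary _ ((hq.mapProj (π := π)).rotation (c ^ k))]
    rw [sub_mul, one_mul, ← Submonoid.coe_mul, inv_mul_cancel_right]
    exact h3
  · rw [norm_div, Complex.norm_ofNat, div_le_one two_pos]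
    exact (norm_add_le _ _).trans (by rw [norm_one, Circle.norm_coe]; norm_num)
  · rw [norm_div, Complex.norm_ofNat, div_le_one two_pos]
    exact (norm_sub_le _ _).trans (by rw [norm_one, Circle.norm_coe]; norm_num)
  · rw [IsStarProjection.coe_rotation, IsStarProjection.coe_rotation, Submonoid.coe_one,
      projRot_eq_comb]
    simp

variable (π) in
/-- `y` is the image of `x` under the derivative at `1` of `π`, along some curve. -/
def DerivRel (x : F) (y : B) : Prop :=
  ∃ g : ℝ → unitary F, g 0 = 1 ∧ HasDerivAt (fun t => (g t : F)) x 0 ∧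
    HasDerivAt (fun t => (π (g t) : B)) y 0

theorem DerivRel.add {x x' : F} {y y' : B} (h : DerivRel π x y) (h' : DerivRel π x' y') :
    DerivRel π (x + x') (y + y') := by
  obtain ⟨g, g0, hx, hy⟩ := h
  obtain ⟨g', g0', hx', hy'⟩ := h'
  refine ⟨g * g', by simp [g0, g0'], ?_, ?_⟩
  · have := hx.mul hx'
    simp only [g0, g0', Submonoid.coe_one, mul_one, one_mul] at this
    exact this
  · have := hy.mul hy'
    simp only [g0, g0', map_one, Submonoid.coe_one, mul_one, one_mul] at this
    simp only [Pi.mul_apply, map_mul]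
    exact this

theorem DerivRel.zero : DerivRel π 0 0 :=
  ⟨1, rfl, hasDerivAt_const _ _, by simpa using hasDerivAt_const _ _⟩

theorem DerivRel.sum {ι : Type*} (s : Finset ι) {x : ι → F} {y : ι → B}
    (h : ∀ i ∈ s, DerivRel π (x i) (y i)) : DerivRel π (∑ i ∈ s, x i) (∑ i ∈ s, y i) := by
  classical
  induction s using Finset.induction_on with
  | empty => simpa using DerivRel.zero
  | insert i s hi ih =>
    rw [Finset.sum_insert hi, Finset.sum_insert hi]
    exact (h i (by simp)).add (ih fun j hj => h j (by simp [hj]))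

theorem DerivRel.eq_zero (hπ : ApproxLinearHom π) {y : B} (h : DerivRel π 0 y) : y = 0 := by
  obtain ⟨g, g0, hx, hy⟩ := h
  refine hy.unique (hasDerivAt_iff_isLittleO.2 ?_)
  have := hasDerivAt_iff_isLittleO.1 hx
  simp only [g0, map_one, Submonoid.coe_one, smul_zero, sub_zero] at this ⊢
  refine Asymptotics.IsBigO.trans_isLittleO (.of_bound 128 (.of_forall fun t => ?_)) this
  exact norm_map_sub_one_le π hπ.near (g t)

theorem ApproxLinearHom.derivRel (hπ : ApproxLinearHom π) {q : F} (hq : IsStarProjection q)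
    (r : ℝ) : DerivRel π ((r * Complex.I) • q) ((r * Complex.I) • mapProj π q) := by
  refine ⟨fun t => hq.rotation (Circle.exp (t * r)), by simp, ?_, ?_⟩
  · exact hasDerivAt_projRot q r
  · simp only [hπ.map_rotation]
    exact hasDerivAt_projRot _ r

theorem ApproxLinearHom.sum_real_eq_zero (hπ : ApproxLinearHom π) {ι : Type*} (s : Finset ι)
    (q : ι → F) (hq : ∀ i, IsStarProjection (q i)) (r : ι → ℝ) (h : ∑ i ∈ s, (r i : ℂ) • q i = 0) :
    ∑ i ∈ s, (r i : ℂ) • mapProj π (q i) = 0 := by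
  have := DerivRel.sum s fun i _ => hπ.derivRel (hq i) (r i)
  simp only [mul_comm _ Complex.I, mul_smul, ← Finset.smul_sum, h, smul_zero] at this
  exact (smul_eq_zero.1 (this.eq_zero hπ)).resolve_left Complex.I_ne_zero

theorem ApproxLinearHom.sum_eq_zero (hπ : ApproxLinearHom π) {ι : Type*} (s : Finset ι)
    (q : ι → F) (hq : ∀ i, IsStarProjection (q i)) (c : ι → ℂ) (h : ∑ i ∈ s, c i • q i = 0) :
    ∑ i ∈ s, c i • mapProj π (q i) = 0 := by
  have hs : ∑ i ∈ s, star (c i) • q i = 0 := by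
    simpa [(hq _).isSelfAdjoint.star_eq] using congrArg star h
  have hre : ∑ i ∈ s, ((c i).re : ℂ) • q i = 0 := by
    have : ∑ i ∈ s, ((c i).re : ℂ) • q i =
        (1 / 2 : ℂ) • (∑ i ∈ s, c i • q i + ∑ i ∈ s, star (c i) • q i) := by
      rw [← Finset.sum_add_distrib, Finset.smul_sum]
      refine Finset.sum_congr rfl fun i _ => ?_
      rw [← add_smul, smul_smul, Complex.re_eq_add_conj]
      congr 1
      simp only [Complex.star_def]
      ring
    rw [this, h, hs, add_zero, smul_zero]
  have him : ∑ i ∈ s, ((c i).im : ℂ) • q i = 0 := by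
    have : ∑ i ∈ s, ((c i).im : ℂ) • q i =
        (1 / (2 * Complex.I) : ℂ) • (∑ i ∈ s, c i • q i - ∑ i ∈ s, star (c i) • q i) := by
      rw [← Finset.sum_sub_distrib, Finset.smul_sum]
      refine Finset.sum_congr rfl fun i _ => ?_
      rw [← sub_smul, smul_smul, Complex.im_eq_sub_conj]
      congr 1
      simp only [Complex.star_def]
      ring
    rw [this, h, hs, sub_zero, smul_zero]
  have h1 := hπ.sum_real_eq_zero s q hq _ hre
  have h2 := hπ.sum_real_eq_zero s q hq _ him
  have : ∑ i ∈ s, c i • mapProj π (q i) = ∑ i ∈ s, ((c i).re : ℂ) • mapProj π (q i) +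
      Complex.I • ∑ i ∈ s, ((c i).im : ℂ) • mapProj π (q i) := by
    rw [Finset.smul_sum, ← Finset.sum_add_distrib]
    refine Finset.sum_congr rfl fun i _ => ?_
    rw [smul_smul, ← add_smul, mul_comm Complex.I, Complex.re_add_im]
  rw [this, h1, h2, smul_zero, add_zero]

end linearization

theorem spectrum.finite_of_finiteDimensional {K A : Type*} [Field K] [Ring A] [Algebra K A]
    [FiniteDimensional K A] (a : A) : (spectrum K a).Finite := by
  refine ((minpoly K a).rootSet_finite K).subset fun x hx => ?_
  rw [Polynomial.mem_rootSet]
  refine ⟨minpoly.ne_zero (Algebra.IsIntegral.isIntegral a), ?_⟩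
  have h := spectrum.subset_polynomial_aeval a (minpoly K a) ⟨x, hx, rfl⟩
  rw [minpoly.aeval] at h
  by_contra h0
  refine h (spectrum.mem_resolventSet_iff.2 ?_)
  simpa using (IsUnit.mk0 _ h0).map (algebraMap K A)

/-- The spectral decomposition of a unitary in a finite-dimensional C*-algebra. -/
theorem exists_spectral_decomposition {F : Type*} [CStarAlgebra F] [FiniteDimensional ℂ F]
    (u : unitary F) :
    ∃ (s : Finset Circle) (p : Circle → F), (∀ z, IsStarProjection (p z)) ∧
      (∀ z w, z ≠ w → p z * p w = 0) ∧ ∑ z ∈ s, p z = 1 ∧ ∑ z ∈ s, (z : ℂ) • p z = u := by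
  have hfin := spectrum.finite_of_finiteDimensional (K := ℂ) (u : F)
  have hc (f : ℂ → ℂ) : ContinuousOn f (spectrum ℂ (u : F)) := hfin.continuousOn f
  have hfin' : ((fun z : Circle => (z : ℂ)) ⁻¹' spectrum ℂ (u : F)).Finite :=
    hfin.preimage Subtype.val_injective.injOn
  have hcirc : ∀ w ∈ spectrum ℂ (u : F), ∃ z : Circle, (z : ℂ) = w := fun w hw =>
    ⟨⟨w, spectrum.subset_circle_of_unitary u.2 hw⟩, rfl⟩
  let f (z : Circle) : ℂ → ℂ := fun w => if w = z then 1 else 0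
  have hsum (g : Circle → ℂ) : ∑ z ∈ hfin'.toFinset, g z • cfc (f z) (u : F) =
      cfc (fun w => ∑ z ∈ hfin'.toFinset, g z * f z w) (u : F) := by
    have : (fun w => ∑ z ∈ hfin'.toFinset, g z * f z w) =
        ∑ z ∈ hfin'.toFinset, fun w => g z * f z w := by ext; simp
    rw [this, cfc_sum _ _ _ fun z _ => hc _]
    exact Finset.sum_congr rfl fun z _ => (cfc_const_mul (g z) (f z) (u : F) (hc _)).symm
  have hsum' (g : Circle → ℂ) (g' : ℂ → ℂ) (hg : ∀ z : Circle, g' z = g z) :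
      ∑ z ∈ hfin'.toFinset, g z • cfc (f z) (u : F) = cfc g' (u : F) := by
    rw [hsum]
    refine cfc_congr fun w hw => ?_
    obtain ⟨z, rfl⟩ := hcirc w hw
    simp only [f, hg]
    rw [Finset.sum_eq_single z]
    · simp
    · intro b _ hb
      rw [if_neg (fun h => hb (Subtype.ext h.symm)), mul_zero]
    · intro h
      exact absurd (hfin'.mem_toFinset.2 hw) h
  refine ⟨hfin'.toFinset, fun z => cfc (f z) (u : F), fun z => ⟨?_, ?_⟩, fun z w hzw => ?_, ?_, ?_⟩
  · rw [IsIdempotentElem, ← cfc_mul (f z) (f z) (u : F) (hc _) (hc _)]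
    congr 1
    ext w
    simp [f]
  · rw [IsSelfAdjoint, ← cfc_star]
    congr 1
    ext w
    simp only [f]
    split_ifs <;> simp
  · rw [← cfc_mul (f z) (f w) (u : F) (hc _) (hc _)]
    convert! cfc_zero ℂ (u : F) using 2
    ext x
    simp only [f]
    split_ifs with h1 h2
    · exact absurd (Subtype.ext (h1.symm.trans h2)) hzw
    all_goals simp
  · have := hsum' (fun _ => 1) (fun _ => 1) fun _ => rfl
    simp only [one_smul] at this
    rw [this, cfc_const_one ..]
  · have := hsum' (fun z => z) (fun z => z) fun _ => rfl
    rw [this, cfc_id' ..]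

section linearization

variable {F B : Type*} [CStarAlgebra F] [CStarAlgebra B]
  {π : unitary F →* unitary B}

theorem ApproxLinearHom.mapProj_one (hπ : ApproxLinearHom π) : mapProj π (1 : F) = 1 := by
  have h1 : IsStarProjection (1 : F) := .one F
  have h2 := h1.mapProj (π := π)
  have h3 : ‖1 - mapProj π (1 : F)‖ ≤ 1 / 4 := by
    have h := hπ.comb 1 1 (h1.rotation (Circle.exp Real.pi)) (-1) 0 (by simp) (by simp)
      (by
        have : ((Circle.exp Real.pi : Circle) : ℂ) = -1 := by simp
        simp only [IsStarProjection.coe_rotation, projRot, this, Submonoid.coe_one]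
        module)
    have : 1 - mapProj π (1 : F) = (1 / 2 : ℂ) • ((π (h1.rotation (Circle.exp Real.pi)) : B) -
        ((-1 : ℂ) • ((π 1 : unitary B) : B) + (0 : ℂ) • ((π 1 : unitary B) : B))) := by
      rw [mapProj, dif_pos h1, map_one, Submonoid.coe_one]
      module
    rw [this, norm_smul, norm_div, norm_one, Complex.norm_ofNat]
    linarith
  have h4 := CStarRing.norm_star_mul_self (x := 1 - mapProj π (1 : F))
  rw [h2.one_sub.isSelfAdjoint.star_eq, h2.one_sub.isIdempotentElem.eq] at h4
  have h5 : ‖1 - mapProj π (1 : F)‖ = 0 := by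
    nlinarith [norm_nonneg (1 - mapProj π (1 : F))]
  exact (sub_eq_zero.1 (norm_eq_zero.1 h5)).symm

theorem ApproxLinearHom.mapProj_mul_eq_zero (hπ : ApproxLinearHom π) {p q : F}
    (hp : IsStarProjection p) (hq : IsStarProjection q) (hpq : p * q = 0) :
    mapProj π p * mapProj π q = 0 := by
  have h1 := hp.add hq hpq
  have h2 : mapProj π (p + q) = mapProj π p + mapProj π q := by
    have := hπ.sum_eq_zero Finset.univ ![p + q, p, q] (by simp [Fin.forall_fin_succ, h1, hp, hq])
      ![1, -1, -1] (by simp [Fin.sum_univ_succ]; abel)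
    simp only [Fin.sum_univ_succ] at this
    simp at this
    rwa [add_eq_zero_iff_eq_neg, ← neg_add, neg_neg] at this
  have : IsAddTorsionFree B := .of_isTorsionFree ℂ B
  have h3 := (hp.mapProj (π := π)).sub_iff_mul_eq_left (h1.mapProj (π := π))
  rw [h2, add_sub_cancel_left, mul_add, hp.mapProj.isIdempotentElem.eq] at h3
  simpa using h3.1 hq.mapProj

theorem ApproxLinearHom.exists_unitary_sum (hπ : ApproxLinearHom π) {p : Circle → F}
    (hp : ∀ z, IsStarProjection (p z)) (hpp : ∀ z w, z ≠ w → p z * p w = 0) (s : Finset Circle) :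
    ∃ v : unitary F, (v : F) = 1 + ∑ z ∈ s, ((z : ℂ) - 1) • p z ∧
      (π v : B) = 1 + ∑ z ∈ s, ((z : ℂ) - 1) • mapProj π (p z) := by
  classical
  induction s using Finset.induction_on with
  | empty => exact ⟨1, by simp, by simp⟩
  | insert z s hz ih =>
    obtain ⟨v, h1, h2⟩ := ih
    refine ⟨v * (hp z).rotation z, ?_, ?_⟩
    · rw [Submonoid.coe_mul, IsStarProjection.coe_rotation, h1, projRot, Finset.sum_insert hz,
        add_mul, one_mul, mul_add, mul_one, Finset.sum_mul,
        Finset.sum_eq_zero (f := fun i : Circle => ((i : ℂ) - 1) • p i * (((z : ℂ) - 1) • p z))]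
      · rw [add_zero, add_assoc]
      · intro w hw
        rw [smul_mul_smul_comm, hpp w z (fun h => hz (h ▸ hw)), smul_zero]
    · rw [map_mul, Submonoid.coe_mul, hπ.map_rotation, IsStarProjection.coe_rotation, h2, projRot,
        Finset.sum_insert hz, add_mul, one_mul, mul_add, mul_one, Finset.sum_mul,
        Finset.sum_eq_zero
          (f := fun i : Circle => ((i : ℂ) - 1) • mapProj π (p i) *
            (((z : ℂ) - 1) • mapProj π (p z)))]
      · rw [add_zero, add_assoc]
      · intro w hw
        rw [smul_mul_smul_comm,
          hπ.mapProj_mul_eq_zero (hp w) (hp z) (hpp w z (fun h => hz (h ▸ hw))), smul_zero]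

variable [FiniteDimensional ℂ F]

theorem ApproxLinearHom.exists_linearMap (hπ : ApproxLinearHom π) :
    ∃ ψ : F →ₗ[ℂ] B, ∀ q, IsStarProjection q → ψ q = mapProj π q := by
  let L := Finsupp.linearCombination ℂ (fun q : {q : F // IsStarProjection q} => (q : F))
  let L' := Finsupp.linearCombination ℂ
    (fun q : {q : F // IsStarProjection q} => mapProj π (q : F))
  have hker : ∀ v, L v = 0 → L' v = 0 := fun v hv =>
    hπ.sum_eq_zero v.support _ (fun q => q.2) _ hv
  have hL : Function.Surjective L := by
    rw [← LinearMap.range_eq_top, Finsupp.range_linearCombination, eq_top_iff,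
      ← CStarAlgebra.span_unitary F, Submodule.span_le]
    intro u hu
    obtain ⟨s, p, hp, -, -, h⟩ := exists_spectral_decomposition ⟨u, hu⟩
    rw [← show _ = u from h]
    exact sum_mem fun z _ => Submodule.smul_mem _ _ (Submodule.subset_span ⟨⟨p z, hp z⟩, rfl⟩)
  obtain ⟨g, hg⟩ := LinearMap.exists_rightInverse_of_surjective L (LinearMap.range_eq_top.2 hL)
  refine ⟨L' ∘ₗ g, fun q hq => ?_⟩
  have h1 : L' (Finsupp.single ⟨q, hq⟩ 1) = mapProj π q := by simp [L']
  have h2 : L (Finsupp.single ⟨q, hq⟩ 1) = q := by simp [L]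
  rw [← h1, LinearMap.comp_apply, ← sub_eq_zero, ← map_sub]
  refine hker _ ?_
  rw [map_sub, h2, sub_eq_zero]
  exact LinearMap.congr_fun hg q

/-- An approximately linear homomorphism of unitary groups extends to a `*`-homomorphism. -/
theorem ApproxLinearHom.exists_starAlgHom (hπ : ApproxLinearHom π) :
    ∃ ψ : F →⋆ₐ[ℂ] B, ∀ u : unitary F, ψ u = π u := by
  obtain ⟨ψ, hψ⟩ := hπ.exists_linearMap
  have h1 : ψ 1 = 1 := (hψ 1 (.one F)).trans hπ.mapProj_one
  have hu (u : unitary F) : ψ u = π u := by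
    obtain ⟨s, p, hp, hpp, hs, hsu⟩ := exists_spectral_decomposition u
    obtain ⟨v, hv, hv'⟩ := hπ.exists_unitary_sum hp hpp s
    have huv : u = v := by
      refine Subtype.ext ?_
      rw [hv, ← hsu, Finset.sum_congr rfl fun (z : Circle) _ => sub_smul (z : ℂ) 1 (p z),
        Finset.sum_sub_distrib]
      simp [hs]
    have h2 : ∑ z ∈ s, mapProj π (p z) = 1 := by
      rw [← h1, ← hs, map_sum]
      exact Finset.sum_congr rfl fun z _ => (hψ _ (hp z)).symm
    rw [huv, hv', ← huv, ← hsu, map_sum,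
      Finset.sum_congr rfl fun (z : Circle) _ => sub_smul (z : ℂ) 1 (mapProj π (p z)),
      Finset.sum_sub_distrib]
    simp only [one_smul, h2, add_sub_cancel]
    exact Finset.sum_congr rfl fun z _ => by rw [map_smul, hψ _ (hp z)]
  have hmul (x y : F) : ψ (x * y) = ψ x * ψ y := by
    have hx : x ∈ Submodule.span ℂ (unitary F : Set F) := CStarAlgebra.span_unitary F ▸ trivial
    have hy : y ∈ Submodule.span ℂ (unitary F : Set F) := CStarAlgebra.span_unitary F ▸ trivial
    induction hx, hy using Submodule.span_induction₂ with
    | mem_mem x y hx hy =>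
      have := hu (⟨x, hx⟩ * ⟨y, hy⟩)
      rw [map_mul, Submonoid.coe_mul, Submonoid.coe_mul, ← hu, ← hu] at this
      exact this
    | zero_left => simp
    | zero_right => simp
    | add_left x y z _ _ _ h h' => simp [add_mul, h, h']
    | add_right x y z _ _ _ h h' => simp [mul_add, h, h']
    | smul_left c x y _ _ h => simp [h]
    | smul_right c x y _ _ h => simp [h]
  have hstar (x : F) : ψ (star x) = star (ψ x) := by
    have hx : x ∈ Submodule.span ℂ (unitary F : Set F) := CStarAlgebra.span_unitary F ▸ trivial
    induction hx using Submodule.span_induction with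
    | mem x hx =>
      have h2 := hu (star ⟨x, hx⟩)
      rw [Unitary.star_eq_inv, map_inv, ← Unitary.star_eq_inv, ← Unitary.star_eq_inv,
        Unitary.coe_star, Unitary.coe_star, ← hu] at h2
      exact h2
    | zero => simp
    | add x y _ _ h h' => simp [h, h']
    | smul c x _ h => simp [h]
  exact ⟨{ AlgHom.ofLinearMap ψ h1 hmul with map_star' := hstar }, hu⟩

end linearization

section near

variable {F B : Type*} [CStarAlgebra F] [FiniteDimensional ℂ F] [CStarAlgebra B] {φ : F → B}
  {ε : ℝ}

/-- An approximate `*`-homomorphism on a finite-dimensional algebra is close to a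
`*`-homomorphism, with constants independent of the algebra. -/
theorem EpsStarHom.exists_starAlgHom_near (h : EpsStarHom ε φ) (hε0 : 0 < ε)
    (hε : ε ≤ 1 / 10000) (h1 : ‖φ 1 - 1‖ ≤ 3 * ε) :
    ∃ ψ : F →⋆ₐ[ℂ] B, ∀ x, ‖x‖ ≤ 1 → ‖ψ x - φ x‖ ≤ 500 * ε := by
  obtain ⟨π, hπ⟩ := h.exists_monoidHom_unitary_near hε0 (by linarith) h1
  have hb (u : unitary F) : ‖(u : F)‖ ≤ 1 := norm_le_one_of_mem_unitary u.2
  have hlin (u v : unitary F) {c d : ℂ} {r : ℝ} (hc : ‖c‖ ≤ r) (hd : ‖d‖ ≤ r) (hr : r ≤ 1) :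
      ‖(c • (π u : B) + d • (π v : B)) - φ (c • (u : F) + d • (v : F))‖ ≤
        ε + 2 * (r * (240 * ε)) := by
    have e1 := h.2.1 u v (hb u) (hb v) c d (hc.trans hr) (hd.trans hr)
    have e2 : (c • (π u : B) + d • (π v : B)) - φ (c • (u : F) + d • (v : F)) =
        (c • ((π u : B) - φ u) + d • ((π v : B) - φ v)) -
          (φ (c • (u : F) + d • (v : F)) - (c • φ u + d • φ v)) := by
      module
    have e3 : ‖c • ((π u : B) - φ u)‖ ≤ r * (240 * ε) := by
      rw [norm_smul]
      exact mul_le_mul hc (hπ u) (norm_nonneg _) ((norm_nonneg _).trans hc)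
    have e4 : ‖d • ((π v : B) - φ v)‖ ≤ r * (240 * ε) := by
      rw [norm_smul]
      exact mul_le_mul hd (hπ v) (norm_nonneg _) ((norm_nonneg _).trans hc)
    rw [e2]
    refine (norm_sub_le_of_le (norm_add_le_of_le e3 e4) e1.le).trans ?_
    linarith
  have hlinear : ApproxLinearHom π := by
    refine ⟨fun u v w c d hc hd hw => ?_, fun u hu => ?_⟩
    · have e1 := hlin u v hc hd le_rfl
      rw [← hw] at e1
      have e2 := norm_sub_le_norm_sub_add_norm_sub (π w : B) (φ w)
        (c • (π u : B) + d • (π v : B))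
      rw [norm_sub_rev] at e1
      linarith [hπ w]
    · have e1 := h.norm_sub_le (hb u) (hb 1) (η := 1 / 16) (by norm_num) (by norm_num) hu
      have e2 := norm_sub_le_norm_sub_add_norm_sub (π u : B) (φ u) 1
      have e3 := norm_sub_le_norm_sub_add_norm_sub (φ u) (φ 1) 1
      rw [Submonoid.coe_one] at e1
      linarith [hπ u]
  obtain ⟨ψ, hψ⟩ := hlinear.exists_starAlgHom
  refine ⟨ψ, fun x hx => ?_⟩
  obtain ⟨u, c, rfl, hc⟩ := CStarAlgebra.exists_sum_four_unitary x
  have hc' (i : Fin 4) : ‖c i‖ ≤ 1 / 2 := (hc i).trans (by linarith)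
  have e1 := hlin (u 0) (u 1) (hc' 0) (hc' 1) (by norm_num)
  have e2 := hlin (u 2) (u 3) (hc' 2) (hc' 3) (by norm_num)
  have hball (i j : Fin 4) : ‖c i • (u i : F) + c j • (u j : F)‖ ≤ 1 := by
    refine (norm_add_le_of_le (r₁ := 1 / 2) (r₂ := 1 / 2) ?_ ?_).trans (by norm_num) <;>
    · rw [norm_smul]
      exact (mul_le_mul (hc' _) (hb _) (norm_nonneg _) (by norm_num)).trans (by norm_num)
  have e3 := h.2.1 _ _ (hball 0 1) (hball 2 3) 1 1 (by simp) (by simp)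
  simp only [one_smul] at e3
  have e4 : ψ (∑ i, c i • (u i : F)) = (c 0 • (π (u 0) : B) + c 1 • (π (u 1) : B)) +
      (c 2 • (π (u 2) : B) + c 3 • (π (u 3) : B)) := by
    simp [Fin.sum_univ_four, hψ, add_assoc]
  have e5 : ∑ i, c i • (u i : F) = (c 0 • (u 0 : F) + c 1 • (u 1 : F)) +
      (c 2 • (u 2 : F) + c 3 • (u 3 : F)) := by
    simp [Fin.sum_univ_four, add_assoc]
  rw [e4, e5, ← sub_add_sub_cancel _ (φ (c 0 • (u 0 : F) + c 1 • (u 1 : F)) +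
    φ (c 2 • (u 2 : F) + c 3 • (u 3 : F))), add_sub_add_comm]
  refine (norm_add_le_of_le (norm_add_le_of_le e1 e2) ((norm_sub_rev _ _).trans_le e3.le)).trans ?_
  linarith

/-- Two nearby `*`-homomorphisms on a finite-dimensional algebra are conjugate by a unitary close
to `1`, with constants independent of the algebra. -/
theorem exists_unitary_conj_of_near (ψ₁ ψ₂ : F →⋆ₐ[ℂ] B) {η : ℝ} (hη : η ≤ 1 / 4)
    (h : ∀ x, ‖x‖ ≤ 1 → ‖ψ₁ x - ψ₂ x‖ ≤ η) :
    ∃ w : unitary B, ‖(w : B) - 1‖ ≤ 3 * η ∧ ∀ x, w * ψ₁ x = ψ₂ x * w := by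
  obtain ⟨M⟩ := InvariantMean.nonempty (unitary F) B
  have hη0 : 0 ≤ η := (norm_nonneg _).trans (h 0 (by simp))
  have hu (ψ : F →⋆ₐ[ℂ] B) (u : unitary F) : ψ u ∈ unitary B := Unitary.map_mem ψ u.2
  have hcont (ψ : F →⋆ₐ[ℂ] B) : Continuous ψ :=
    (ψ : F →ₗ[ℂ] B).continuous_of_finiteDimensional
  obtain ⟨f, hf⟩ : ∃ f : C(unitary F, B), ∀ u, f u = ψ₂ u * star (ψ₁ u) :=
    ⟨⟨fun u => ψ₂ u * star (ψ₁ u), by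
      have h1 := hcont ψ₁
      have h2 := hcont ψ₂
      fun_prop⟩, fun u => rfl⟩
  have hfu : f ∈ unitary C(unitary F, B) := ContinuousMap.mem_unitary_iff.2 fun u => by
    rw [hf]
    exact mul_mem (hu _ _) (Unitary.star_mem (hu _ _))
  set w₀ := M.toLinearMap f with hw₀
  have hw1 : ‖w₀‖ ≤ 1 := (M.norm_le f).trans (norm_le_one_of_mem_unitary hfu)
  have hwη : ‖w₀ - 1‖ ≤ η := by
    refine M.norm_map_sub_le ((ContinuousMap.norm_le _ hη0).2 fun u => ?_)
    have : (f - .const (unitary F) 1) u = (ψ₂ u - ψ₁ u) * star (ψ₁ u) := by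
      simp [hf, sub_mul, Unitary.mul_star_self_of_mem (hu ψ₁ u)]
    rw [this, CStarRing.norm_mul_mem_unitary _ (Unitary.star_mem (hu _ _)), norm_sub_rev]
    exact h u (norm_le_one_of_mem_unitary u.2)
  have hwη' : ‖star w₀ - 1‖ ≤ η := by
    rw [← norm_star, star_sub, star_star, star_one]; exact hwη
  have htr (v : unitary F) : w₀ = ψ₂ v * w₀ * star (ψ₁ v) := by
    have : f.comp (ContinuousMap.mulLeft v) =
        .const _ (ψ₂ v) * f * .const _ (star (ψ₁ v)) := by
      ext u
      simp [hf, mul_assoc]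
    rw [← M.map_const_mul, ← M.map_mul_const, ← this, M.map_translate]
  have hint (v : unitary F) : w₀ * ψ₁ v = ψ₂ v * w₀ := by
    nth_rw 1 [htr v]
    rw [mul_assoc, Unitary.star_mul_self_of_mem (hu ψ₁ v), mul_one]
  have hint' (v : unitary F) : ψ₁ v * star w₀ = star w₀ * ψ₂ v := by
    have := congrArg star (hint (star v))
    rwa [star_mul, star_mul, ← map_star ψ₁, ← map_star ψ₂, Unitary.coe_star, star_star] at this
  obtain ⟨k, hk, hkn, hkc⟩ := exists_polar w₀ (η := 2 * η) (by linarith)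
    (by
      rw [norm_sub_rev]
      have := norm_mul_sub_mul_le (a := star w₀) (b := w₀) (a' := 1) (b' := 1)
        (norm_le_one_of_mem_unitary (one_mem _)) hw1 hwη' hwη
      rw [mul_one] at this
      linarith)
    (by
      rw [norm_sub_rev]
      have := norm_mul_sub_mul_le (a := w₀) (b := star w₀) (a' := 1) (b' := 1)
        (norm_le_one_of_mem_unitary (one_mem _)) (by rwa [norm_star]) hwη hwη'
      rw [mul_one] at this
      linarith)
  refine ⟨⟨w₀ * k, hk⟩, ?_, fun x => ?_⟩
  · have := norm_sub_le_norm_sub_add_norm_sub (w₀ * k) w₀ 1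
    change ‖w₀ * k - 1‖ ≤ _
    linarith
  · change w₀ * k * ψ₁ x = ψ₂ x * (w₀ * k)
    have hx : x ∈ Submodule.span ℂ (unitary F : Set F) := CStarAlgebra.span_unitary F ▸ trivial
    induction hx using Submodule.span_induction with
    | mem v hv =>
      have h1 := hint ⟨v, hv⟩
      have h2 := hint' ⟨v, hv⟩
      have h3 : Commute (ψ₁ v) k := hkc _ (by
        rw [Commute, SemiconjBy, ← mul_assoc, h2, mul_assoc, ← h1, mul_assoc])
      rw [mul_assoc, ← h3.eq, ← mul_assoc, h1, mul_assoc]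
    | zero => simp
    | add x y _ _ h h' => simp only [map_add, mul_add, add_mul, h, h']
    | smul c x _ h => simp only [map_smul, mul_smul_comm, smul_mul_assoc, h]

end near

section extension

variable {A B : Type*} [CStarAlgebra A] [CStarAlgebra B]

open Filter Topology in
/-- A coherent sequence of isometric `*`-homomorphisms on an increasing sequence of subalgebras
with dense union extends to the whole algebra. -/
theorem exists_starAlgHom_of_coherent (S : ℕ → StarSubalgebra ℂ A) (hS : Monotone S)
    (hdense : Dense (⋃ n, (S n : Set A))) (θ : ∀ n, S n →⋆ₐ[ℂ] B)
    (hθ : ∀ n x, ‖θ n x‖ = ‖x‖)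
    (hcoh : ∀ n (x : S n), θ (n + 1) (StarSubalgebra.inclusion (hS n.le_succ) x) = θ n x) :
    ∃ Ψ : A →⋆ₐ[ℂ] B, (∀ x, ‖Ψ x‖ = ‖x‖) ∧ ∀ n (x : S n), Ψ x = θ n x := by
  have hcoh' {n m : ℕ} (h : n ≤ m) (x : S n) :
      θ m (StarSubalgebra.inclusion (hS h) x) = θ n x := by
    induction m, h using Nat.le_induction with
    | base => rfl
    | succ m h ih => exact (hcoh m (StarSubalgebra.inclusion (hS h) x)).trans ih
  have hdiff {n m : ℕ} (h : n ≤ m) (x : S n) (y : S m) :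
      ‖θ n x - θ m y‖ = ‖(x : A) - y‖ := by
    rw [← hcoh' h, ← map_sub, hθ]; rfl
  have hdist (n m : ℕ) (x : S n) (y : S m) : dist (θ n x) (θ m y) = dist (x : A) y := by
    obtain h | h := le_total n m
    · rw [dist_eq_norm, hdiff h, dist_eq_norm]
    · rw [dist_comm, dist_eq_norm, hdiff h, dist_comm, dist_eq_norm]
  have happrox (a : A) : ∃ x : ∀ n, S n, Tendsto (fun n => (x n : A)) atTop (𝓝 a) := by
    have h1 (n : ℕ) : ∃ y ∈ (S n : Set A), dist a y < Metric.infDist a (S n) + 1 / (n + 1) :=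
      (Metric.infDist_lt_iff ⟨0, zero_mem (S n)⟩).1 (by
        linarith [show (0 : ℝ) < 1 / ((n : ℝ) + 1) by positivity])
    choose y hy hlt using h1
    refine ⟨fun n => ⟨y n, hy n⟩, Metric.tendsto_atTop.2 fun r hr => ?_⟩
    obtain ⟨z, hz, hdz⟩ := Metric.mem_closure_iff.1 (hdense a) (r / 2) (by positivity)
    obtain ⟨N, hN⟩ := Set.mem_iUnion.1 hz
    obtain ⟨M, hM⟩ := exists_nat_one_div_lt (show (0 : ℝ) < r / 2 by positivity)
    refine ⟨max N M, fun n hn => ?_⟩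
    have h2 : Metric.infDist a (S n) ≤ dist a z :=
      Metric.infDist_le_dist_of_mem (hS ((le_max_left _ _).trans hn) hN)
    have h3 : (1 : ℝ) / (n + 1) ≤ 1 / (M + 1) := by
      have : (M : ℝ) ≤ n := by exact_mod_cast (le_max_right _ _).trans hn
      gcongr
    rw [dist_comm]
    change dist a (y n) < r
    linarith [hlt n]
  have hcauchy (x : ∀ n, S n) (a : A) (h : Tendsto (fun n => (x n : A)) atTop (𝓝 a)) :
      ∃ b, Tendsto (fun n => θ n (x n)) atTop (𝓝 b) := by
    refine cauchySeq_tendsto_of_complete (Metric.cauchySeq_iff.2 fun r hr => ?_)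
    obtain ⟨N, hN⟩ := Metric.cauchySeq_iff.1 h.cauchySeq r hr
    exact ⟨N, fun m hm n hn => (hdist _ _ _ _).trans_lt (hN m hm n hn)⟩
  choose c hc using happrox
  choose Ψ hΨ using fun a => hcauchy (c a) a (hc a)
  have key (a : A) (x : ∀ n, S n) (h : Tendsto (fun n => (x n : A)) atTop (𝓝 a)) :
      Tendsto (fun n => θ n (x n)) atTop (𝓝 (Ψ a)) := by
    refine (tendsto_iff_of_dist ?_).1 (hΨ a)
    simp only [hdist]
    simpa using (hc a).dist h
  have hext (n : ℕ) (x : S n) : Ψ x = θ n x := by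
    have h1 := key x (fun m => if h : n ≤ m then StarSubalgebra.inclusion (hS h) x else 0)
      (tendsto_const_nhds.congr' (by
        filter_upwards [eventually_ge_atTop n] with m hm
        rw [dif_pos hm]; rfl))
    refine tendsto_nhds_unique h1 (tendsto_const_nhds.congr' ?_)
    filter_upwards [eventually_ge_atTop n] with m hm
    rw [dif_pos hm, hcoh' hm]
  have halg (r : ℂ) : Ψ (algebraMap ℂ A r) = algebraMap ℂ B r := by
    have := hext 0 (algebraMap ℂ (S 0) r)
    rw [AlgHomClass.commutes] at this
    exact this
  have hmul (x y : A) : Ψ (x * y) = Ψ x * Ψ y := by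
    refine tendsto_nhds_unique (key (x * y) (fun n => c x n * c y n) ?_) ?_
    · simpa using (hc x).mul (hc y)
    · simpa using (hΨ x).mul (hΨ y)
  have hadd (x y : A) : Ψ (x + y) = Ψ x + Ψ y := by
    refine tendsto_nhds_unique (key (x + y) (fun n => c x n + c y n) ?_) ?_
    · simpa using (hc x).add (hc y)
    · simpa using (hΨ x).add (hΨ y)
  have hstar (x : A) : Ψ (star x) = star (Ψ x) := by
    refine tendsto_nhds_unique (key (star x) (fun n => star (c x n)) ?_) ?_
    · simpa using (hc x).star
    · simpa [map_star] using (hΨ x).star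
  have hnorm (x : A) : ‖Ψ x‖ = ‖x‖ := by
    refine tendsto_nhds_unique (hΨ x).norm ?_
    simpa [hθ] using (hc x).norm
  refine ⟨{ toFun := Ψ, map_one' := by simpa using halg 1, map_zero' := by simpa using halg 0,
            map_mul' := hmul, map_add' := hadd, commutes' := halg, map_star' := hstar },
    hnorm, hext⟩

end extension

theorem LinearMap.surjective_of_near {A B : Type*} [NormedAddCommGroup A] [NormedSpace ℂ A]
    [CompleteSpace A] [NormedAddCommGroup B] [NormedSpace ℂ B] (Ψ : A →ₗ[ℂ] B)
    (hiso : ∀ x, ‖Ψ x‖ = ‖x‖) (hnear : ∀ b, ‖b‖ ≤ 1 → ∃ x, ‖b - Ψ x‖ ≤ 1 / 2) :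
    Function.Surjective Ψ := by
  have hclosed : IsClosed (Ψ.range : Set B) := by
    rw [LinearMap.coe_range]
    exact (AddMonoidHomClass.isometry_of_norm Ψ hiso).isClosedEmbedding.isClosed_range
  by_contra h
  obtain ⟨b, hb, hb'⟩ := riesz_lemma hclosed
    (by simpa [Function.Surjective, LinearMap.mem_range] using h) (r := 3 / 4) (by norm_num)
  have hb0 : 0 < ‖b‖ := norm_pos_iff.2 fun h0 => hb (h0 ▸ zero_mem _)
  obtain ⟨x, hx⟩ := hnear (((‖b‖ : ℂ))⁻¹ • b) (by
    rw [norm_smul, norm_inv, Complex.norm_real, norm_norm, inv_mul_cancel₀ hb0.ne'])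
  have h1 := hb' (Ψ ((‖b‖ : ℂ) • x)) ⟨_, rfl⟩
  have h2 : b - Ψ ((‖b‖ : ℂ) • x) = (‖b‖ : ℂ) • ((‖b‖ : ℂ)⁻¹ • b - Ψ x) := by
    rw [smul_sub, smul_inv_smul₀ (by exact_mod_cast hb0.ne'), map_smul]
  rw [h2, norm_smul, Complex.norm_real, norm_norm] at h1
  nlinarith

theorem IsAF.exists_starSubalgebra {A : Type*} [CStarAlgebra A] (hA : IsAF A) :
    ∃ S : ℕ → StarSubalgebra ℂ A, Monotone S ∧ (∀ n, FiniteDimensional ℂ (S n)) ∧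
      Dense (⋃ n, (S n : Set A)) := by
  obtain ⟨S, hS, hfd, hd⟩ := hA
  refine ⟨fun n => StarAlgebra.adjoin ℂ (S n : Set A), fun m n hmn =>
    StarAlgebra.adjoin_mono (hS hmn), fun n => ?_,
    hd.mono (Set.iUnion_mono fun n => StarAlgebra.subset_adjoin ℂ _)⟩
  have : FiniteDimensional ℂ (Unitization ℂ (S n)) :=
    (Unitization.linearEquiv ℂ ℂ (S n)).symm.finiteDimensional
  change FiniteDimensional ℂ (StarAlgebra.adjoin ℂ (S n : Set A))
  rw [← NonUnitalStarSubalgebra.unitization_range]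
  exact LinearMap.finiteDimensional_range
    ((NonUnitalStarSubalgebra.unitization (S n) : Unitization ℂ (S n) →⋆ₐ[ℂ] A) :
      Unitization ℂ (S n) →ₗ[ℂ] A)

theorem EpsIsomorphism.norm_map_one_sub_one_le {A B : Type*} [CStarAlgebra A] [CStarAlgebra B]
    {φ : A → B} {ε : ℝ} (h : EpsIsomorphism ε φ) : ‖φ 1 - 1‖ ≤ 3 * ε := by
  have hA : ‖(1 : A)‖ ≤ 1 := norm_le_one_of_mem_unitary (one_mem _)
  obtain ⟨⟨⟨hc, -, -, hm⟩, -⟩, hs⟩ := h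
  obtain ⟨x, hx, hxε⟩ := hs 1 (norm_le_one_of_mem_unitary (one_mem _))
  have h2 := hm 1 x hA hx
  rw [one_mul, norm_sub_rev] at h2
  have h3 : ‖φ 1 * (1 - φ x)‖ ≤ ε := by
    refine (norm_mul_le _ _).trans ?_
    nlinarith [hc 1 hA, norm_nonneg (φ 1), norm_nonneg (1 - φ x)]
  have h4 : φ 1 - 1 = φ 1 * (1 - φ x) + (φ 1 * φ x - φ x) - (1 - φ x) := by
    rw [mul_sub, mul_one]; abel
  rw [h4]
  linarith [norm_sub_le (φ 1 * (1 - φ x) + (φ 1 * φ x - φ x)) (1 - φ x),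
    norm_add_le (φ 1 * (1 - φ x)) (φ 1 * φ x - φ x)]

/-- The elements of norm at most `1` of a dense increasing union of subalgebras approximate
the closed unit ball. -/
theorem exists_mem_norm_le_one_of_dense {A : Type*} [CStarAlgebra A]
    {S : ℕ → StarSubalgebra ℂ A} (hS : Monotone S) (hd : Dense (⋃ n, (S n : Set A))) {x : A}
    (hx : ‖x‖ ≤ 1) (k : ℕ) {t : ℝ} (ht0 : 0 < t) (ht1 : t ≤ 1) :
    ∃ m, k < m ∧ ∃ y : S m, ‖(y : A)‖ ≤ 1 ∧ ‖x - y‖ ≤ 2 * t := by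
  obtain ⟨y, hy, hdy⟩ := Metric.mem_closure_iff.1 (hd ((1 - t : ℝ) • x)) t ht0
  obtain ⟨n, hn⟩ := Set.mem_iUnion.1 hy
  have h1 : ‖(1 - t : ℝ) • x‖ ≤ 1 - t := by
    rw [norm_smul, Real.norm_of_nonneg (by linarith)]
    exact mul_le_of_le_one_right (by linarith) hx
  have h2 : ‖x - (1 - t : ℝ) • x‖ ≤ t := by
    rw [sub_smul, one_smul, sub_sub_cancel, norm_smul, Real.norm_of_nonneg ht0.le]
    exact mul_le_of_le_one_right ht0.le hx
  rw [dist_eq_norm] at hdy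
  refine ⟨max n (k + 1), by simp, ⟨y, hS (le_max_left _ _) hn⟩, ?_, ?_⟩
  · have := norm_le_norm_add_norm_sub' y ((1 - t : ℝ) • x)
    rw [norm_sub_rev] at this
    change ‖y‖ ≤ 1
    linarith
  · change ‖x - y‖ ≤ _
    linarith [norm_sub_le_norm_sub_add_norm_sub x ((1 - t : ℝ) • x) y]

section intertwining

variable {A B : Type*} [CStarAlgebra A] [CStarAlgebra B] {φ : A → B} {ε : ℝ}

theorem EpsEmbedding.norm_map_eq (h : EpsEmbedding ε φ) (hε : ε ≤ 1 / 100000)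
    {S : StarSubalgebra ℂ A} [IsClosed (S : Set A)] (ψ : S →⋆ₐ[ℂ] B)
    (hψ : ∀ x, ‖x‖ ≤ 1 → ‖ψ x - φ x‖ ≤ 500 * ε) (x : S) : ‖ψ x‖ = ‖x‖ := by
  refine NonUnitalStarAlgHom.norm_map ψ ((injective_iff_map_eq_zero ψ).2 fun x hx => ?_) x
  by_contra h0
  have h1 : 0 < ‖x‖ := norm_pos_iff.2 h0
  have h2 : ‖((‖x‖ : ℂ))⁻¹ • x‖ = 1 := by
    rw [norm_smul, norm_inv, Complex.norm_real, norm_norm, inv_mul_cancel₀ h1.ne']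
  have h3 := hψ _ h2.le
  have h4 : ‖(‖x‖ : ℂ)⁻¹ • x‖ - ‖φ ((‖x‖ : ℂ)⁻¹ • x : S)‖ < ε := (abs_lt.1 (h.2 _ h2.le)).2
  rw [map_smul, hx, smul_zero, zero_sub, norm_neg] at h3
  linarith

/-- `ψ` conjugated by the unitary `v`. -/
noncomputable def conjHom {F : Type*} [Semiring F] [Algebra ℂ F] [Star F] (ψ : F →⋆ₐ[ℂ] B)
    (v : unitary B) : F →⋆ₐ[ℂ] B :=
  ((Unitary.conjStarAlgAut ℂ B v : B ≃⋆ₐ[ℂ] B) : B →⋆ₐ[ℂ] B).comp ψ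

theorem conjHom_apply {F : Type*} [Semiring F] [Algebra ℂ F] [Star F] (ψ : F →⋆ₐ[ℂ] B)
    (v : unitary B) (x : F) : conjHom ψ v x = v * ψ x * star (v : B) := rfl

theorem EpsIsomorphism.exists_conjHom_extension (h : EpsIsomorphism ε φ) (hε0 : 0 < ε)
    (hε : ε ≤ 1 / 100000) {S : ℕ → StarSubalgebra ℂ A} (hS : Monotone S)
    [∀ n, FiniteDimensional ℂ (S n)] (hd : Dense (⋃ n, (S n : Set A)))
    (ψ : ∀ n, S n →⋆ₐ[ℂ] B) (hψ : ∀ n x, ‖x‖ ≤ 1 → ‖ψ n x - φ x‖ ≤ 500 * ε)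
    (k : ℕ) (v : unitary B) {b : B} (hb : ‖b‖ ≤ 1) :
    ∃ (m : ℕ) (hkm : k < m) (v' : unitary B),
      (∀ x : S k, conjHom (ψ m) v' (StarSubalgebra.inclusion (hS hkm.le) x) = conjHom (ψ k) v x) ∧
      ∃ y : S m, ‖b - conjHom (ψ m) v' y‖ ≤ 1 / 4 := by
  have hcl (n : ℕ) : IsClosed (S n : Set A) :=
    Submodule.closed_of_finiteDimensional (S n).toSubalgebra.toSubmodule
  have hvb : ‖star (v : B) * b * v‖ ≤ 1 := by
    rwa [CStarRing.norm_mul_coe_unitary, ← Unitary.coe_star, CStarRing.norm_coe_unitary_mul]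
  obtain ⟨x, hx, hcx⟩ := h.2 _ hvb
  obtain ⟨m, hkm, y, hy, hxy⟩ := exists_mem_norm_le_one_of_dense hS hd hx k
    (show (0 : ℝ) < 1 / 100 by norm_num) (by norm_num)
  obtain ⟨w, hw, hconj⟩ := exists_unitary_conj_of_near
    ((ψ m).comp (StarSubalgebra.inclusion (hS hkm.le))) (ψ k) (η := 1000 * ε) (by linarith)
    fun z hz => by
      have h1 := hψ m (StarSubalgebra.inclusion (hS hkm.le) z) hz
      have h2 := hψ k z hz
      rw [norm_sub_rev] at h2
      have h3 := norm_sub_le_norm_sub_add_norm_sub (ψ m (StarSubalgebra.inclusion (hS hkm.le) z))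
        (φ z) (ψ k z)
      change ‖ψ m (StarSubalgebra.inclusion (hS hkm.le) z) - φ z‖ ≤ _ at h1
      change ‖ψ m (StarSubalgebra.inclusion (hS hkm.le) z) - ψ k z‖ ≤ _
      linarith
  have hconj' (z : S k) : (w : B) * ψ m (StarSubalgebra.inclusion (hS hkm.le) z) = ψ k z * w :=
    hconj z
  refine ⟨m, hkm, v * w, fun z => ?_, y, ?_⟩
  · rw [conjHom_apply, conjHom_apply, Submonoid.coe_mul, star_mul, mul_assoc (v : B), hconj']
    simp only [mul_assoc]
    rw [← mul_assoc (w : B), Unitary.mul_star_self_of_mem w.2, one_mul]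
  · have h1 : ‖ψ m y‖ ≤ 1 := (NonUnitalStarAlgHom.norm_apply_le (ψ m) y).trans hy
    have h3 : ‖star (v : B) * b * v - ψ m y‖ ≤ 3 / 100 := by
      have e1 := h.1.1.norm_sub_le hx hy (by norm_num) (by norm_num) hxy
      have e2 := hψ m y hy
      rw [norm_sub_rev] at e2
      linarith [norm_sub_le_norm_sub_add_norm_sub (star (v : B) * b * v) (φ x) (ψ m y),
        norm_sub_le_norm_sub_add_norm_sub (φ x) (φ y) (ψ m y)]
    have h4 : ‖b - conjHom (ψ m) (v * w) y‖ = ‖star (v : B) * b * v * w - w * ψ m y‖ := by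
      have e : star (v : B) * b * v * w - w * ψ m y =
          ((star v : unitary B) : B) * (b - conjHom (ψ m) (v * w) y) * (v * w : unitary B) := by
        have e1 : (v : B) * w * ψ m y * (star (w : B) * star (v : B)) * (v * w) =
            v * w * ψ m y := by
          rw [mul_assoc (_ * ψ m y), mul_assoc (star (w : B)), ← mul_assoc (star (v : B)),
            Unitary.star_mul_self_of_mem v.2, one_mul, Unitary.star_mul_self_of_mem w.2, mul_one]
        rw [conjHom_apply, Submonoid.coe_mul, star_mul, Unitary.coe_star,
          mul_assoc (star (v : B)) (_ - _), sub_mul, e1, mul_sub, mul_assoc (v : B) w, ← mul_assoc (star (v : B)) v,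
          Unitary.star_mul_self_of_mem v.2, one_mul]
        simp only [mul_assoc]
      rw [e, CStarRing.norm_mul_coe_unitary, CStarRing.norm_coe_unitary_mul]
    have h5 : star (v : B) * b * v * w - w * ψ m y = (star (v : B) * b * v - ψ m y) +
        star (v : B) * b * v * (w - 1) - (w - 1) * ψ m y := by
      rw [mul_sub, sub_mul]; simp only [mul_one, one_mul]; abel
    have h6 : ‖star (v : B) * b * v * (w - 1)‖ ≤ ‖(w : B) - 1‖ :=
      (norm_mul_le _ _).trans (mul_le_of_le_one_left (norm_nonneg _) hvb)
    have h7 : ‖((w : B) - 1) * ψ m y‖ ≤ ‖(w : B) - 1‖ :=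
      (norm_mul_le _ _).trans (mul_le_of_le_one_right (norm_nonneg _) h1)
    rw [h4, h5]
    linarith [norm_sub_le (star (v : B) * b * v - ψ m y + star (v : B) * b * v * (w - 1))
      ((w - 1) * ψ m y), norm_add_le (star (v : B) * b * v - ψ m y)
      (star (v : B) * b * v * (w - 1))]

theorem EpsIsomorphism.exists_starAlgHom_bijective [TopologicalSpace.SeparableSpace A]
    (h : EpsIsomorphism ε φ) (hε0 : 0 < ε) (hε : ε ≤ 1 / 100000) (hA : IsAF A) :
    ∃ Ψ : A →⋆ₐ[ℂ] B, Function.Bijective Ψ := by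
  obtain ⟨S, hS, hfd, hd⟩ := hA.exists_starSubalgebra
  have hcl (n : ℕ) : IsClosed (S n : Set A) :=
    Submodule.closed_of_finiteDimensional (S n).toSubalgebra.toSubmodule
  have hψ (n : ℕ) : ∃ ψ : S n →⋆ₐ[ℂ] B, ∀ x, ‖x‖ ≤ 1 → ‖ψ x - φ x‖ ≤ 500 * ε := by
    obtain ⟨hc, hl, hs, hm⟩ := h.1.1
    have hres : EpsStarHom ε fun x : S n => φ x :=
      ⟨fun x => hc x, fun x y => hl x y, fun x => hs x, fun x y => hm x y⟩
    exact hres.exists_starAlgHom_near hε0 (by linarith) h.norm_map_one_sub_one_le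
  choose ψ hψ using hψ
  have hne : Nonempty (Metric.closedBall (0 : A) 1) := ⟨⟨0, by simp⟩⟩
  have hx (n : ℕ) : ‖(TopologicalSpace.denseSeq (Metric.closedBall (0 : A) 1) n : A)‖ ≤ 1 :=
    mem_closedBall_zero_iff.1 (TopologicalSpace.denseSeq (Metric.closedBall (0 : A) 1) n).2
  choose next hlt vnext hext hnear using fun (n k : ℕ) (v : unitary B) =>
    h.exists_conjHom_extension hε0 hε hS hd ψ hψ k v (h.1.1.1 _ (hx n))
  let s : ℕ → ℕ × unitary B :=
    fun n => Nat.rec (0, 1) (fun n p => (next n p.1 p.2, vnext n p.1 p.2)) n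
  have hsmono : StrictMono fun n => (s n).1 := strictMono_nat_of_lt_succ fun n => hlt n _ _
  have hSs : Monotone fun n => S (s n).1 := hS.comp hsmono.monotone
  obtain ⟨Ψ, hΨ, hΨs⟩ := exists_starAlgHom_of_coherent (fun n => S (s n).1) hSs
    (hd.mono (Set.iUnion_mono fun n => hS (hsmono.id_le n)))
    (fun n => conjHom (ψ (s n).1) (s n).2)
    (fun n x => by
      rw [conjHom_apply, ← Unitary.coe_star, CStarRing.norm_mul_coe_unitary,
        CStarRing.norm_coe_unitary_mul, h.1.norm_map_eq hε _ (hψ _)])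
    (fun n x => hext n _ _ x)
  refine ⟨Ψ, (AddMonoidHomClass.isometry_of_norm Ψ hΨ).injective,
    LinearMap.surjective_of_near (Ψ : A →ₗ[ℂ] B) hΨ fun b hb => ?_⟩
  obtain ⟨x, hx1, hbx⟩ := h.2 b hb
  obtain ⟨n, hn⟩ := (TopologicalSpace.denseRange_denseSeq
    (Metric.closedBall (0 : A) 1)).exists_dist_lt ⟨x, by simpa using hx1⟩
    (show (0 : ℝ) < 1 / 10 by norm_num)
  rw [Subtype.dist_eq, dist_eq_norm] at hn
  obtain ⟨y, hy⟩ := hnear n (s n).1 (s n).2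
  have h1 := h.1.1.norm_sub_le hx1 (hx n) (by norm_num) (by norm_num) hn.le
  refine ⟨(y : A), ?_⟩
  have h2 := hΨs (n + 1) y
  change ‖b - Ψ y‖ ≤ _
  rw [h2]
  change ‖_ - conjHom (ψ (s (n + 1)).1) (s (n + 1)).2 y‖ ≤ _ at hy
  linarith [norm_sub_le_norm_sub_add_norm_sub b (φ x) (conjHom (ψ (s (n + 1)).1) (s (n + 1)).2 y),
    norm_sub_le_norm_sub_add_norm_sub (φ x)
      (φ (TopologicalSpace.denseSeq (Metric.closedBall (0 : A) 1) n))
      (conjHom (ψ (s (n + 1)).1) (s (n + 1)).2 y)]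

end intertwining

/-- A C*-algebra with a two-sided identity, as a unital C*-algebra. -/
noncomputable abbrev NonUnitalCStarAlgebra.toCStarAlgebra {B : Type*}
    [i : NonUnitalCStarAlgebra B] (e : B) (he : ∀ b, e * b = b) (he' : ∀ b, b * e = b) :
    CStarAlgebra B :=
  letI : NormedRing B := { i.toNonUnitalNormedRing with one := e, one_mul := he, mul_one := he' }
  letI : Algebra ℂ B := Algebra.ofModule smul_mul_assoc mul_smul_comm
  letI : NormedAlgebra ℂ B := ⟨norm_smul_le⟩
  { }

/-- A C*-algebra which is `ε`-isomorphic to a unital one is unital. -/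
theorem EpsIsomorphism.exists_identity {A B : Type*} [CStarAlgebra A] [NonUnitalCStarAlgebra B]
    {φ : A → B} {ε : ℝ} (h : EpsIsomorphism ε φ) (hε : ε ≤ 1 / 10) :
    ∃ e : B, (∀ b, e * b = b) ∧ ∀ b, b * e = b := by
  have hA : ‖(1 : A)‖ ≤ 1 := norm_le_one_of_mem_unitary (one_mem _)
  obtain ⟨⟨⟨hc, -, -, hm⟩, -⟩, hs⟩ := h
  have hball (b : B) (hb : ‖b‖ ≤ 1) : ‖φ 1 * b - b‖ ≤ 3 * ε := by
    obtain ⟨x, hx, hxε⟩ := hs b hb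
    have h2 := hm 1 x hA hx
    rw [one_mul, norm_sub_rev] at h2
    have h3 : ‖φ 1 * (b - φ x)‖ ≤ ε := by
      refine (norm_mul_le _ _).trans ?_
      nlinarith [hc 1 hA, norm_nonneg (φ 1), norm_nonneg (b - φ x)]
    have h4 : φ 1 * b - b = φ 1 * (b - φ x) + (φ 1 * φ x - φ x) - (b - φ x) := by
      rw [mul_sub]; abel
    rw [h4]
    linarith [norm_sub_le (φ 1 * (b - φ x) + (φ 1 * φ x - φ x)) (b - φ x),
      norm_add_le (φ 1 * (b - φ x)) (φ 1 * φ x - φ x)]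
  have hε0 : 0 ≤ 3 * ε := (norm_nonneg _).trans (hball 0 (by simp))
  have hnorm : ‖ContinuousLinearMap.mul ℂ B (φ 1) - 1‖ ≤ 3 * ε :=
    ContinuousLinearMap.opNorm_le_of_unit_norm hε0 fun b hb => hball b hb.le
  obtain ⟨u, hu⟩ : IsUnit (ContinuousLinearMap.mul ℂ B (φ 1)) := by
    have := isUnit_one_sub_of_norm_lt_one (x := 1 - ContinuousLinearMap.mul ℂ B (φ 1)) (by
      rw [norm_sub_rev]; linarith)
    rwa [sub_sub_cancel] at this
  have hinj (b : B) (hb : φ 1 * b = 0) : b = 0 := by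
    have h1 : (↑u⁻¹ * ↑u : B →L[ℂ] B) b = b := by simp
    rw [← h1, mul_apply_eq_comp, hu, ContinuousLinearMap.mul_apply', hb, map_zero]
  obtain ⟨e, he⟩ : ∃ e, φ 1 * e = φ 1 := by
    refine ⟨(↑u⁻¹ : B →L[ℂ] B) (φ 1), ?_⟩
    have h1 : (↑u * ↑u⁻¹ : B →L[ℂ] B) (φ 1) = φ 1 := by simp
    rwa [mul_apply_eq_comp, hu] at h1
  have hl (b : B) : e * b = b :=
    sub_eq_zero.1 (hinj _ (by rw [mul_sub, ← mul_assoc, he, sub_self]))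
  have hr (b : B) : b * star e = b := by
    rw [← star_star (b * star e), star_mul, star_star, hl, star_star]
  have hee : star e = e := (hl _).symm.trans (hr e)
  exact ⟨e, hl, fun b => by simpa [hee] using hr b⟩

/-- There is `ε₀ > 0` such that whenever `0 < ε < ε₀`, `A` is a unital separable AF algebra,
`B` is any C*-algebra, and there is an `ε`-isomorphism from `A` to `B`, then `A` and `B` are
`*`-isomorphic. -/
theorem af_isomorphic_of_eps_isomorphism :
    ∃ ε₀ : ℝ, 0 < ε₀ ∧
      ∀ (A B : Type) [CStarAlgebra A] [TopologicalSpace.SeparableSpace A]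
        [NonUnitalCStarAlgebra B] (ε : ℝ), 0 < ε → ε < ε₀ → IsAF A →
        (∃ φ : A → B, EpsIsomorphism ε φ) →
        ∃ ψ : A →⋆ₙₐ[ℂ] B, Function.Bijective ψ := by
  refine ⟨1 / 100000, by norm_num, ?_⟩
  rintro A B _ _ _ ε hε0 hε hA ⟨φ, h⟩
  obtain ⟨e, he, he'⟩ := h.exists_identity (by linarith)
  let _ := NonUnitalCStarAlgebra.toCStarAlgebra e he he'
  obtain ⟨Ψ, hΨ⟩ := EpsIsomorphism.exists_starAlgHom_bijective (φ := φ) h hε0 hε.le hA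
  exact ⟨(Ψ : A →⋆ₙₐ[ℂ] B), hΨ⟩
end

section
/- If H and K are hereditary nonmeager subsets of P(ℕ), then H ∩ K is hereditary and nonmeager. -/
open scoped Classical in
/-- The characteristic function of a subset of `ℕ`, as a point of the Cantor space `ℕ → Bool`.
This identifies `𝒫(ℕ)` with the Cantor space `2^ℕ` carrying the product topology. -/
noncomputable def charFun (S : Set ℕ) : ℕ → Bool := fun n => if n ∈ S then true else false

/-- A family of subsets of `ℕ` is meager if the corresponding subset of the Cantor space
`ℕ → Bool` is meager. -/
def MeagerFamily (J : Set (Set ℕ)) : Prop := IsMeagre (charFun '' J)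

/-- A hereditary family of subsets of `ℕ`. -/
def Hereditary (H : Set (Set ℕ)) : Prop := ∀ A B : Set ℕ, A ⊆ B → B ∈ H → A ∈ H

open Set Topology

/-- Two points that agree on a long enough initial segment lie in the same open set. -/
theorem exists_forall_lt_eq_imp_mem {U : Set (ℕ → Bool)} (hU : IsOpen U) {x : ℕ → Bool}
    (hx : x ∈ U) : ∃ p : ℕ, ∀ y : ℕ → Bool, (∀ i < p, y i = x i) → y ∈ U := by
  obtain ⟨v, ⟨z, p, rfl⟩, hxv, hvU⟩ :=
    (PiNat.isTopologicalBasis_cylinders (fun _ : ℕ => Bool)).exists_subset_of_mem_open hx hU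
  refine ⟨p, fun y hy => hvU ?_⟩
  rw [PiNat.mem_cylinder_iff] at hxv ⊢
  exact fun i hi => (hy i hi).trans (hxv i hi)

/-- Pointwise exclusive or with a fixed sequence, as a homeomorphism of the Cantor space. -/
def xorHomeomorph (s : ℕ → Bool) : (ℕ → Bool) ≃ₜ (ℕ → Bool) where
  toFun x i := xor (s i) (x i)
  invFun x i := xor (s i) (x i)
  left_inv x := by ext i; simp
  right_inv x := by ext i; simp
  continuous_toFun := continuous_pi fun i =>
    (continuous_of_discreteTopology (f := xor (s i))).comp (continuous_apply i)
  continuous_invFun := continuous_pi fun i =>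
    (continuous_of_discreteTopology (f := xor (s i))).comp (continuous_apply i)

theorem finite_setOf_forall_ge_eq_false (n : ℕ) :
    {s : ℕ → Bool | ∀ i, n ≤ i → s i = false}.Finite := by
  refine Set.Finite.of_finite_image (f := fun s (i : Fin n) => s i) (Set.toFinite _) ?_
  intro s hs t ht hst
  funext i
  by_cases hi : i < n
  · exact congrFun hst ⟨i, hi⟩
  · rw [hs i (not_lt.1 hi), ht i (not_lt.1 hi)]

/-- Given a dense open subset of the Cantor space, some pattern on some interval `[n, m)` forces
membership in it. -/
theorem exists_pattern_imp_mem {U : Set (ℕ → Bool)} (hU : IsOpen U) (hd : Dense U) (n : ℕ) :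
    ∃ (m : ℕ) (t : ℕ → Bool), ∀ x : ℕ → Bool,
      (∀ i, n ≤ i → i < m → x i = t i) → x ∈ U := by
  have hfin := finite_setOf_forall_ge_eq_false n
  have hdense : Dense (⋂ s ∈ {s : ℕ → Bool | ∀ i, n ≤ i → s i = false},
      xorHomeomorph s ⁻¹' U) :=
    dense_biInter_of_isOpen (fun s _ => hU.preimage (xorHomeomorph s).continuous)
      hfin.countable (fun s _ => hd.preimage (xorHomeomorph s).isOpenMap)
  obtain ⟨t, ht⟩ := hdense.nonempty
  have key : ∀ s : ℕ → Bool, ∃ p : ℕ, (∀ i, n ≤ i → s i = false) →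
      ∀ y : ℕ → Bool, (∀ i < p, y i = xor (s i) (t i)) → y ∈ U := fun s => by
    by_cases hs : ∀ i, n ≤ i → s i = false
    · obtain ⟨p, hp⟩ := exists_forall_lt_eq_imp_mem hU (mem_iInter₂.1 ht s hs)
      exact ⟨p, fun _ y hy => hp y hy⟩
    · exact ⟨0, fun h => absurd h hs⟩
  choose p hp using key
  obtain ⟨m, hm⟩ := (hfin.image p).bddAbove
  refine ⟨m, t, fun x hx => ?_⟩
  have hs : ∀ i, n ≤ i → (if i < n then xor (x i) (t i) else false) = false :=
    fun i hi => if_neg (not_lt.2 hi)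
  refine hp _ hs x fun i hi => ?_
  by_cases hin : i < n
  · simp [hin]
  · simpa [hin] using hx i (not_lt.1 hin) (hi.trans_le (hm ⟨_, hs, rfl⟩))

/-- A generic point of the Cantor space matches infinitely many of the given patterns. -/
theorem residual_infinite_setOf_match {I : Set ℕ} (hI : I.Infinite) (m : ℕ → ℕ)
    (t : ℕ → ℕ → Bool) :
    {x : ℕ → Bool | {n ∈ I | ∀ i, n ≤ i → i < m n → x i = t n i}.Infinite} ∈
      residual (ℕ → Bool) := by
  let M : ℕ → Set (ℕ → Bool) := fun n => {x | ∀ i, n ≤ i → i < m n → x i = t n i}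
  have hM : ∀ n, IsOpen (M n) := fun n => by
    have : M n = ⋂ i ∈ Set.Ico n (m n), {x | x i = t n i} := by
      ext x; simp [M]
    rw [this]
    exact (Set.finite_Ico n (m n)).isOpen_biInter fun i _ =>
      (isOpen_discrete {t n i}).preimage (continuous_apply (A := fun _ : ℕ => Bool) i)
  have hD : ∀ k, (⋃ n ∈ I ∩ Set.Ioi k, M n) ∈ residual (ℕ → Bool) := fun k => by
    refine residual_of_dense_open (isOpen_biUnion fun n _ => hM n) ?_
    refine dense_iff_inter_open.2 fun V hV ⟨y, hy⟩ => ?_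
    obtain ⟨p, hp⟩ := exists_forall_lt_eq_imp_mem hV hy
    obtain ⟨n, hnI, hn⟩ := hI.exists_gt (max k p)
    refine ⟨fun i => if i < n then y i else t n i, hp _ fun i hi => ?_,
      mem_iUnion₂.2 ⟨n, ⟨hnI, (le_max_left _ _).trans_lt hn⟩, fun i hi _ => if_neg (not_lt.2 hi)⟩⟩
    exact if_pos (hi.trans ((le_max_right _ _).trans_lt hn))
  filter_upwards [countable_iInter_mem.2 hD] with x hx
  refine Set.infinite_of_not_bddAbove fun ⟨k, hk⟩ => ?_
  obtain ⟨n, ⟨hnI, hkn⟩, hxn⟩ := mem_iUnion₂.1 (mem_iInter.1 hx k)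
  exact (hk ⟨hnI, hxn⟩).not_gt hkn

/-- Points matching infinitely many suitable patterns belong to a given residual set. -/
theorem exists_patterns_of_mem_residual {R : Set (ℕ → Bool)} (hR : R ∈ residual (ℕ → Bool)) :
    ∃ (m : ℕ → ℕ) (t : ℕ → ℕ → Bool), ∀ x : ℕ → Bool,
      {n | ∀ i, n ≤ i → i < m n → x i = t n i}.Infinite → x ∈ R := by
  obtain ⟨S, hSo, hSd, hSc, hSR⟩ := mem_residual_iff.1 hR
  obtain ⟨U, hU⟩ := (hSc.insert univ).exists_eq_range (insert_nonempty _ _)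
  have hUS : ∀ j, IsOpen (U j) ∧ Dense (U j) := fun j => by
    rcases (hU ▸ mem_range_self j : U j ∈ insert univ S) with h | h
    · rw [h]; exact ⟨isOpen_univ, dense_univ⟩
    · exact ⟨hSo _ h, hSd _ h⟩
  have key : ∀ n : ℕ, ∃ (m : ℕ) (t : ℕ → Bool), ∀ x : ℕ → Bool,
      (∀ i, n ≤ i → i < m → x i = t i) → x ∈ ⋂ j ∈ Set.Iic n, U j := fun n =>
    exists_pattern_imp_mem ((Set.finite_Iic n).isOpen_biInter fun j _ => (hUS j).1)
      (dense_biInter_of_isOpen (fun j _ => (hUS j).1) (Set.to_countable _)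
        fun j _ => (hUS j).2) n
  choose m t hmt using key
  refine ⟨m, t, fun x hx => hSR fun V hV => ?_⟩
  obtain ⟨j, rfl⟩ : V ∈ range U := hU ▸ mem_insert_of_mem _ hV
  obtain ⟨n, hn, hjn⟩ := hx.exists_gt j
  exact mem_iInter₂.1 (hmt n x hn) j hjn.le

/-- A nonmeager family has a member whose characteristic function lies in a given residual set. -/
theorem exists_charFun_mem_of_not_meagerFamily {J : Set (Set ℕ)} (hJ : ¬ MeagerFamily J)
    {R : Set (ℕ → Bool)} (hR : R ∈ residual (ℕ → Bool)) : ∃ A ∈ J, charFun A ∈ R := by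
  by_contra! h
  refine hJ (Filter.mem_of_superset hR ?_)
  rintro _ hx ⟨A, hA, rfl⟩
  exact h A hA hx

theorem charFun_inter_apply (A B : Set ℕ) (i : ℕ) :
    charFun (A ∩ B) i = (charFun A i && charFun B i) := by
  by_cases hA : i ∈ A <;> by_cases hB : i ∈ B <;> simp [charFun, hA, hB]

/-- The intersection of two hereditary nonmeager subsets of `𝒫(ℕ)` is hereditary and
nonmeager. -/
theorem inter_hereditary_nonmeager (H K : Set (Set ℕ))
    (hherH : Hereditary H) (hherK : Hereditary K)
    (hH : ¬ MeagerFamily H) (hK : ¬ MeagerFamily K) :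
    Hereditary (H ∩ K) ∧ ¬ MeagerFamily (H ∩ K) := by
  refine ⟨fun A B hAB hB => ⟨hherH A B hAB hB.1, hherK A B hAB hB.2⟩, fun hmeagre => ?_⟩
  obtain ⟨m, t, hmt⟩ := exists_patterns_of_mem_residual hmeagre
  obtain ⟨A, hA, hAI⟩ := exists_charFun_mem_of_not_meagerFamily hH
    (residual_infinite_setOf_match Set.infinite_univ m t)
  obtain ⟨B, hB, hBI⟩ := exists_charFun_mem_of_not_meagerFamily hK
    (residual_infinite_setOf_match hAI m t)
  refine hmt (charFun (A ∩ B)) (hBI.mono ?_) ⟨A ∩ B,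
    ⟨hherH _ _ Set.inter_subset_left hA, hherK _ _ Set.inter_subset_right hB⟩, rfl⟩
  rintro n ⟨⟨-, hAn⟩, hBn⟩ i hi him
  rw [charFun_inter_apply, hAn i hi him, hBn i hi him, Bool.and_self]
end
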